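/- arXiv:1711.06941 — 2 statements merged into one kernel-verified Lean document; each statement's English description precedes it below -/
import Mathlib

section
/- For every real s > 0, the identity ∏_{j≥0} (1 + 2^{−j} s) = √s · exp((log s)²/(2 log 2) + P(log₂ s)) · ∏_{j≥1} 1/(1 + 2^{−j}/s) holds, where both infinite products converge. -/
open Filter Real

/-- The 1-periodic function
`P(t) = log 2/12 + π²/(6 log 2) − ∑_{j≥1} cos(2jπt)/(j sinh(2jπ²/log 2))`. -/
noncomputable def P (t : ℝ) : ℝ :=
  Real.log 2 / 12 + Real.pi^2 / (6 * Real.log 2) -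
    ∑' j : ℕ, Real.cos (2 * ((j:ℝ)+1) * Real.pi * t) /
      (((j:ℝ)+1) * Real.sinh (2 * ((j:ℝ)+1) * Real.pi^2 / Real.log 2))

open Topology MeasureTheory

lemma alt_of (h : ℕ → ℝ) (A O : ℝ) (hA : HasSum h A) (hO : HasSum (fun k => h (2 * k + 1)) O) :
    HasSum (fun k => (-1 : ℝ) ^ k * h k) (A - 2 * O) := by
  have hE : Summable (fun k => h (2 * k)) :=
    hA.summable.comp_injective (i := fun k => 2 * k) (fun a b hab => by simpa using hab)
  have h1 := HasSum.even_add_odd hE.hasSum hO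
  have h2 := h1.unique hA
  have h3 : HasSum (fun k => (-1 : ℝ) ^ k * h k) ((∑' k, h (2 * k)) + -O) := by
    apply HasSum.even_add_odd
    · simpa [pow_mul] using hE.hasSum
    · simpa [pow_succ, pow_mul] using hO.neg
  convert h3 using 1
  linarith

lemma coth_sum (w : ℝ) (hw : 0 < w) :
    HasSum (fun k : ℕ => 1 / (((k : ℝ) + 1) ^ 2 + w ^ 2))
      ((Real.pi * Real.cosh (Real.pi * w) / Real.sinh (Real.pi * w) - 1 / w) / (2 * w)) := by
  have hs : Real.sinh (Real.pi * w) ≠ 0 := by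
    have : 0 < Real.sinh (Real.pi * w) := Real.sinh_pos_iff.mpr (by positivity)
    exact this.ne'
  have hmem : ((w : ℂ) * Complex.I) ∈ Complex.integerComplement := by
    rw [Complex.integerComplement]
    rintro ⟨n, hn⟩
    have := congrArg Complex.im hn
    simp at this
    exact hw.ne this
  have h := cot_series_rep' hmem
  have hsum : Summable (fun k : ℕ => 1 / (((k : ℝ) + 1) ^ 2 + w ^ 2)) := by
    have h0 : Summable (fun k : ℕ => 1 / ((k : ℝ) + 1) ^ 2) := by
      have := (summable_nat_add_iff 1).mpr (Real.summable_one_div_nat_pow.mpr (one_lt_two))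
      simpa using this
    refine h0.of_nonneg_of_le (fun k => by positivity) (fun k => ?_)
    apply one_div_le_one_div_of_le (by positivity)
    nlinarith [sq_nonneg w]
  have key : ∀ n : ℕ, (1 / ((w : ℂ) * Complex.I - (n + 1)) + 1 / ((w : ℂ) * Complex.I + (n + 1)))
      = (-2 * w * Complex.I) * ((1 / (((n : ℝ) + 1) ^ 2 + w ^ 2) : ℝ) : ℂ) := by
    intro n
    have h1 : (w : ℂ) * Complex.I - (n + 1) ≠ 0 := by
      intro h; have := congrArg Complex.im h; simp at this; exact hw.ne' this
    have h2 : (w : ℂ) * Complex.I + (n + 1) ≠ 0 := by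
      intro h; have := congrArg Complex.im h; simp at this; exact hw.ne' this
    have h3 : (((n : ℂ) + 1) ^ 2 + w ^ 2) ≠ 0 := by
      have : (((n : ℝ) + 1) ^ 2 + w ^ 2) ≠ 0 := by positivity
      exact_mod_cast this
    push_cast
    rw [div_add_div _ _ h1 h2, mul_one_div, div_eq_div_iff (mul_ne_zero h1 h2) h3]
    ring_nf
    simp [show Complex.I ^ 3 = -Complex.I by simp [pow_succ]]
  simp_rw [key] at h
  rw [tsum_mul_left, ← Complex.ofReal_tsum] at h
  rw [Complex.cot, show (Real.pi : ℂ) * (w * Complex.I) = ((Real.pi * w : ℝ) : ℂ) * Complex.I by push_cast; ring,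
    Complex.cos_mul_I, Complex.sin_mul_I, ← Complex.ofReal_cosh, ← Complex.ofReal_sinh] at h
  have hs' : (Real.sinh (Real.pi * w) : ℂ) ≠ 0 := by exact_mod_cast hs
  have hw' : (w : ℂ) ≠ 0 := by exact_mod_cast hw.ne'
  have h4 : (((Real.pi * Real.cosh (Real.pi * w) / Real.sinh (Real.pi * w) - 1 / w) / (2 * w) : ℝ) : ℂ)
      = ((∑' k : ℕ, 1 / (((k : ℝ) + 1) ^ 2 + w ^ 2) : ℝ) : ℂ) := by
    have h5 : ∀ T : ℂ, (Real.pi : ℂ) * ((Real.cosh (Real.pi * w) : ℂ) / ((Real.sinh (Real.pi * w) : ℂ) * Complex.I))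
      - 1 / (w * Complex.I) = -2 * w * Complex.I * T →
      ((Real.pi : ℂ) * Real.cosh (Real.pi * w) / Real.sinh (Real.pi * w) - 1 / w) / (2 * w) = T := by
      intro T hT
      have hI := Complex.I_ne_zero
      field_simp at hT ⊢
      rw [Complex.I_sq] at hT
      linear_combination hT
    have := h5 _ h
    push_cast at this ⊢
    exact this
  have h6 := Complex.ofReal_injective h4
  rw [h6]
  exact hsum.hasSum

lemma alt_sum (w : ℝ) (hw : 0 < w) :
    HasSum (fun k : ℕ => (-1 : ℝ) ^ k * (1 / (((k : ℝ) + 1) ^ 2 + w ^ 2)))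
      (1 / (2 * w ^ 2) - Real.pi / (2 * w * Real.sinh (Real.pi * w))) := by
  have h1 := coth_sum w hw
  have h2 := (coth_sum (w / 2) (by positivity)).mul_left (1 / 4)
  have h4 : (fun k : ℕ => 1 / ((((2 * k + 1 : ℕ) : ℝ) + 1) ^ 2 + w ^ 2)) =
      fun k : ℕ => 1 / 4 * (1 / (((k : ℝ) + 1) ^ 2 + (w / 2) ^ 2)) := by
    funext k
    have e1 : (((k : ℝ) + 1) ^ 2 + (w / 2) ^ 2) ≠ 0 := by positivity
    have e2 : ((((2 * k + 1 : ℕ) : ℝ) + 1) ^ 2 + w ^ 2) ≠ 0 := by positivity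
    rw [one_div_mul_one_div, div_eq_div_iff e2 (by positivity)]
    push_cast
    ring
  rw [← h4] at h2
  have h3 := alt_of (fun k : ℕ => 1 / (((k : ℝ) + 1) ^ 2 + w ^ 2)) _ _ h1 h2
  convert h3 using 1
  have hd : Real.pi * w = 2 * (Real.pi * (w / 2)) := by ring
  have hs : 0 < Real.sinh (Real.pi * (w / 2)) := Real.sinh_pos_iff.mpr (by positivity)
  have hc : 0 < Real.cosh (Real.pi * (w / 2)) := Real.cosh_pos _
  rw [hd, Real.sinh_two_mul, Real.cosh_two_mul]
  have := Real.cosh_sq (Real.pi * (w / 2))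
  generalize Real.sinh (Real.pi * (w / 2)) = x at *
  generalize Real.cosh (Real.pi * (w / 2)) = y at *
  have hpi := Real.pi_pos
  generalize Real.pi = p at *
  field_simp
  linear_combination (4 * w * p) * this

lemma alt_sum_zero : HasSum (fun k : ℕ => (-1 : ℝ) ^ k * (1 / (((k : ℝ) + 1) ^ 2 + 0 ^ 2)))
      (Real.pi ^ 2 / 12) := by
  have h1 : HasSum (fun k : ℕ => 1 / (((k : ℝ) + 1) ^ 2 + 0 ^ 2)) (Real.pi ^ 2 / 6) := by
    have := (hasSum_nat_add_iff' 1).mpr hasSum_zeta_two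
    simpa using this
  have h2 := h1.mul_left (1 / 4)
  have h4 : (fun k : ℕ => 1 / ((((2 * k + 1 : ℕ) : ℝ) + 1) ^ 2 + 0 ^ 2)) =
      fun k : ℕ => 1 / 4 * (1 / (((k : ℝ) + 1) ^ 2 + 0 ^ 2)) := by
    funext k
    have e1 : (((k : ℝ) + 1) ^ 2 + 0 ^ 2) ≠ 0 := by positivity
    have e2 : ((((2 * k + 1 : ℕ) : ℝ) + 1) ^ 2 + 0 ^ 2) ≠ 0 := by positivity
    rw [one_div_mul_one_div, div_eq_div_iff e2 (by positivity)]
    push_cast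
    ring
  rw [← h4] at h2
  have h3 := alt_of (fun k : ℕ => 1 / (((k : ℝ) + 1) ^ 2 + 0 ^ 2)) _ _ h1 h2
  convert h3 using 1
  ring
open FourierTransform in
lemma exp_abs_integrable (c : ℝ) (hc : 0 < c) (w : ℝ) :
    Integrable (fun v : ℝ => Complex.exp (↑(-2 * Real.pi * v * w) * Complex.I) *
      (Real.exp (-c * |v|) : ℂ)) ∧
    ∫ v : ℝ, Complex.exp (↑(-2 * Real.pi * v * w) * Complex.I) * (Real.exp (-c * |v|) : ℂ)
      = ((2 * c / (c ^ 2 + (2 * Real.pi * w) ^ 2) : ℝ) : ℂ) := by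
  set f : ℝ → ℂ := fun v : ℝ => Complex.exp (↑(-2 * Real.pi * v * w) * Complex.I) *
      (Real.exp (-c * |v|) : ℂ) with hf
  set z1 : ℂ := c - 2 * Real.pi * w * Complex.I with hz1
  set z2 : ℂ := -c - 2 * Real.pi * w * Complex.I with hz2
  have r1 : 0 < z1.re := by simp [hz1, hc]
  have r2 : z2.re < 0 := by simp [hz2, hc]
  have e1 : Set.EqOn (fun x : ℝ => Complex.exp (z1 * x)) f (Set.Iic 0) := by
    intro x hx
    simp only [hf, Complex.ofReal_exp, ← Complex.exp_add]
    rw [abs_of_nonpos hx]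
    congr 1
    rw [hz1]; push_cast; ring
  have e2 : Set.EqOn (fun x : ℝ => Complex.exp (z2 * x)) f (Set.Ioi 0) := by
    intro x hx
    simp only [hf, Complex.ofReal_exp, ← Complex.exp_add]
    rw [abs_of_pos hx]
    congr 1
    rw [hz2]; push_cast; ring
  have i1 : IntegrableOn f (Set.Iic 0) :=
    (integrableOn_congr_fun e1 measurableSet_Iic).mp (integrableOn_exp_mul_complex_Iic r1 0)
  have i2 : IntegrableOn f (Set.Ioi 0) :=
    (integrableOn_congr_fun e2 measurableSet_Ioi).mp (integrableOn_exp_mul_complex_Ioi r2 0)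
  refine ⟨?_, ?_⟩
  · rw [← integrableOn_univ, ← Set.Iic_union_Ioi (a := (0 : ℝ))]
    exact i1.union i2
  · rw [← intervalIntegral.integral_Iic_add_Ioi i1 i2,
      ← setIntegral_congr_fun measurableSet_Iic e1, ← setIntegral_congr_fun measurableSet_Ioi e2,
      integral_exp_mul_complex_Iic r1, integral_exp_mul_complex_Ioi r2]
    have n1 : z1 ≠ 0 := fun h => by rw [h] at r1; simp at r1
    have n2 : z2 ≠ 0 := fun h => by rw [h] at r2; simp at r2
    have n3 : ((c : ℂ) ^ 2 + (2 * Real.pi * w) ^ 2) ≠ 0 := by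
      have : (c ^ 2 + (2 * Real.pi * w) ^ 2) ≠ 0 := by positivity
      exact_mod_cast this
    simp only [Complex.ofReal_zero, mul_zero, Complex.exp_zero]
    push_cast
    rw [div_add_div _ _ n1 n2, div_eq_div_iff (mul_ne_zero n1 n2) n3, hz1, hz2]
    have hI := Complex.I_sq
    linear_combination (-8 * (c:ℂ) * Real.pi ^ 2 * w ^ 2) * hI

open FourierTransform in
lemma ft_L (a : ℝ) (ha : 0 < a) (w S : ℝ)
    (hS : HasSum (fun k : ℕ => (-1 : ℝ) ^ k * (1 / (((k : ℝ) + 1) ^ 2 + (2 * Real.pi * w / a) ^ 2))) S) :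
    𝓕 (fun x : ℝ => ((Real.log (1 + Real.exp (-a * |x|)) : ℝ) : ℂ)) w = ((2 / a * S : ℝ) : ℂ) := by
  rw [Real.fourier_real_eq_integral_exp_smul]
  set F : ℕ → ℝ → ℂ := fun k v => (((-1 : ℝ) ^ k / (k + 1) : ℝ) : ℂ) *
    (Complex.exp (↑(-2 * Real.pi * v * w) * Complex.I) * (Real.exp (-(a * (k + 1)) * |v|) : ℂ)) with hF
  have hc : ∀ k : ℕ, 0 < a * ((k : ℝ) + 1) := fun k => by positivity
  have hint : ∀ k, Integrable (F k) := fun k => ((exp_abs_integrable _ (hc k) w).1).const_mul _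
  have hnorm : ∀ k, ∫ v, ‖F k v‖ = 2 / a * (1 / ((k : ℝ) + 1) ^ 2) := by
    intro k
    have h0 := (exp_abs_integrable _ (hc k) 0).2
    have h1 : ∀ v, ‖F k v‖ = 1 / ((k : ℝ) + 1) * Real.exp (-(a * (k + 1)) * |v|) := by
      intro v
      simp only [hF]
      rw [norm_mul, norm_mul, Complex.norm_exp_ofReal_mul_I, Complex.norm_real, Complex.norm_real,
        Real.norm_of_nonneg (Real.exp_pos _).le, norm_div, norm_pow, norm_neg, norm_one, one_pow,
        Real.norm_of_nonneg (by positivity : (0 : ℝ) ≤ k + 1), one_mul]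
    simp_rw [h1]
    rw [integral_const_mul]
    have h2 : ∫ v : ℝ, Real.exp (-(a * (k + 1)) * |v|) = 2 * (a * (k + 1)) / ((a * (k + 1)) ^ 2 + (2 * Real.pi * 0) ^ 2) := by
      apply Complex.ofReal_injective
      rw [← h0, ← integral_complex_ofReal]
      simp
    rw [h2]
    have : (k : ℝ) + 1 ≠ 0 := by positivity
    field_simp
    simp
  have hsum0 : Summable (fun k : ℕ => 1 / ((k : ℝ) + 1) ^ 2) := by
    have := (summable_nat_add_iff 1).mpr (Real.summable_one_div_nat_pow.mpr (one_lt_two))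
    simpa using this
  have hmain := hasSum_integral_of_summable_integral_norm hint (by
    simp_rw [hnorm]; exact hsum0.mul_left _)
  have hpt : ∫ v, ∑' k, F k v = ∫ v : ℝ, Complex.exp (↑(-2 * Real.pi * v * w) * Complex.I) •
      ((Real.log (1 + Real.exp (-a * |v|)) : ℝ) : ℂ) := by
    apply integral_congr_ae
    have hne : ∀ᵐ v : ℝ, v ≠ 0 := by
      simp [ae_iff]
    filter_upwards [hne] with v hv
    have hlt : Real.exp (-a * |v|) < 1 := by
      rw [Real.exp_lt_one_iff]
      have := abs_pos.mpr hv
      nlinarith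
    have hlog := Real.hasSum_pow_div_log_of_abs_lt_one (x := -Real.exp (-a * |v|)) (by
      rw [abs_neg, abs_of_pos (Real.exp_pos _)]; exact hlt)
    have hlog2 := hlog.neg
    rw [neg_neg, sub_neg_eq_add] at hlog2
    have hlog3 := (Complex.hasSum_ofReal.mpr hlog2).mul_left
      (Complex.exp (↑(-2 * Real.pi * v * w) * Complex.I))
    rw [smul_eq_mul, ← hlog3.tsum_eq]
    apply tsum_congr
    intro k
    simp only [hF]
    have : Real.exp (-(a * (k + 1)) * |v|) = Real.exp (-a * |v|) ^ (k + 1) := by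
      rw [← Real.exp_nat_mul]; congr 1; push_cast; ring
    rw [this, neg_pow (Real.exp (-a * |v|)), pow_succ (-1 : ℝ)]
    push_cast
    ring
  rw [hpt] at hmain
  refine hmain.unique ?_
  have h5 := Complex.hasSum_ofReal.mpr (hS.mul_left (2 / a))
  suffices hk : ∀ k, ∫ v, F k v = ((2 / a * ((-1 : ℝ) ^ k * (1 / (((k : ℝ) + 1) ^ 2 + (2 * Real.pi * w / a) ^ 2))) : ℝ) : ℂ) by
    simp_rw [hk]; exact h5
  intro k
  simp only [hF]
  rw [integral_const_mul, (exp_abs_integrable _ (hc k) w).2, ← Complex.ofReal_mul]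
  congr 1
  have : (k : ℝ) + 1 ≠ 0 := by positivity
  have h6 : (a * ((k : ℝ) + 1)) ^ 2 + (2 * Real.pi * w) ^ 2 ≠ 0 := by positivity
  have h7 : ((k : ℝ) + 1) ^ 2 + (2 * Real.pi * w / a) ^ 2 = ((a * ((k : ℝ) + 1)) ^ 2 + (2 * Real.pi * w) ^ 2) / a ^ 2 := by
    field_simp
  rw [h7]
  field_simp
noncomputable def UU (a t : ℝ) : ℝ := ∑' j : ℕ, Real.log (1 + Real.exp (a * (t - j)))

lemma UU_summable (a t : ℝ) (ha : 0 < a) :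
    Summable (fun j : ℕ => Real.log (1 + Real.exp (a * (t - j)))) := by
  apply Real.summable_log_one_add_of_summable
  have h : (fun j : ℕ => Real.exp (a * (t - j))) =
      fun j : ℕ => Real.exp (a * t) * Real.exp (-a) ^ j := by
    funext j
    rw [← Real.exp_nat_mul, ← Real.exp_add]
    congr 1; ring
  rw [h]
  apply Summable.mul_left
  apply summable_geometric_of_lt_one (Real.exp_pos _).le
  rw [Real.exp_lt_one_iff]; linarith

lemma UU_succ (a t : ℝ) (ha : 0 < a) :
    UU a (t + 1) = Real.log (1 + Real.exp (a * (t + 1))) + UU a t := by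
  unfold UU
  rw [(UU_summable a (t + 1) ha).tsum_eq_zero_add]
  congr 1
  · simp
  · apply tsum_congr
    intro j
    push_cast
    congr 4
    ring

lemma L_decay (a : ℝ) (ha : 0 < a) :
    Asymptotics.IsBigO (cocompact ℝ)
      (fun x : ℝ => ((Real.log (1 + Real.exp (-a * |x|)) : ℝ) : ℂ)) (fun x : ℝ => |x| ^ (-2 : ℝ)) := by
  apply Asymptotics.IsBigO.of_bound (2 / a ^ 2)
  filter_upwards [(isCompact_singleton (x := (0 : ℝ))).compl_mem_cocompact] with x hx
  have hx0 : 0 < |x| := abs_pos.mpr (by simpa using hx)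
  have h1 : 0 ≤ Real.log (1 + Real.exp (-a * |x|)) :=
    Real.log_nonneg (by linarith [Real.exp_pos (-a * |x|)])
  rw [Complex.norm_real, Real.norm_of_nonneg h1, Real.norm_of_nonneg (by positivity)]
  have h2 : Real.log (1 + Real.exp (-a * |x|)) ≤ Real.exp (-a * |x|) := by
    have := Real.log_le_sub_one_of_pos (x := 1 + Real.exp (-a * |x|)) (by positivity)
    linarith
  refine h2.trans ?_
  have h3 := Real.quadratic_le_exp_of_nonneg (x := a * |x|) (by positivity)
  rw [Real.rpow_neg hx0.le, Real.rpow_two, neg_mul, Real.exp_neg]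
  have h4 : (a * |x|) ^ 2 / 2 ≤ Real.exp (a * |x|) := by nlinarith [mul_pos ha hx0]
  calc (Real.exp (a * |x|))⁻¹ ≤ ((a * |x|) ^ 2 / 2)⁻¹ := inv_anti₀ (by positivity) h4
    _ = _ := by field_simp

noncomputable def cc (a : ℝ) (k : ℕ) : ℝ := a / (2 * Real.pi ^ 2) * (1 / ((k : ℝ) + 1) ^ 2) -
  1 / (((k : ℝ) + 1) * Real.sinh (2 * ((k : ℝ) + 1) * Real.pi ^ 2 / a))

lemma sum_sq : Summable (fun k : ℕ => 1 / ((k : ℝ) + 1) ^ 2) := by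
  have := (summable_nat_add_iff 1).mpr (Real.summable_one_div_nat_pow.mpr (one_lt_two))
  simpa using this

lemma sum_sinh (a : ℝ) (ha : 0 < a) : Summable (fun k : ℕ =>
    1 / (((k : ℝ) + 1) * Real.sinh (2 * ((k : ℝ) + 1) * Real.pi ^ 2 / a))) := by
  have hpi := Real.pi_pos
  refine (sum_sq.mul_left (a / (2 * Real.pi ^ 2))).of_nonneg_of_le (fun k => ?_) (fun k => ?_)
  · have : 0 < Real.sinh (2 * ((k : ℝ) + 1) * Real.pi ^ 2 / a) :=
      Real.sinh_pos_iff.mpr (by positivity)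
    positivity
  · have h : 2 * ((k : ℝ) + 1) * Real.pi ^ 2 / a ≤ Real.sinh (2 * ((k : ℝ) + 1) * Real.pi ^ 2 / a) :=
      Real.self_le_sinh_iff.mpr (by positivity)
    calc 1 / (((k : ℝ) + 1) * Real.sinh (2 * ((k : ℝ) + 1) * Real.pi ^ 2 / a))
        ≤ 1 / (((k : ℝ) + 1) * (2 * ((k : ℝ) + 1) * Real.pi ^ 2 / a)) := by gcongr
      _ = _ := by field_simp

lemma sum_cc (a : ℝ) (ha : 0 < a) : Summable (cc a) :=
  (sum_sq.mul_left _).sub (sum_sinh a ha)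

open FourierTransform in
lemma ft_zero (a : ℝ) (ha : 0 < a) :
    𝓕 (fun x : ℝ => ((Real.log (1 + Real.exp (-a * |x|)) : ℝ) : ℂ)) 0 =
      ((Real.pi ^ 2 / (6 * a) : ℝ) : ℂ) := by
  rw [ft_L a ha 0 (Real.pi ^ 2 / 12) (by simpa using alt_sum_zero)]
  congr 1
  field_simp
  norm_num

open FourierTransform in
lemma ft_ne (a : ℝ) (ha : 0 < a) (k : ℕ) (x : ℝ) (hx : x = k + 1 ∨ x = -(k + 1)) :
    𝓕 (fun x : ℝ => ((Real.log (1 + Real.exp (-a * |x|)) : ℝ) : ℂ)) x =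
      ((cc a k / 2 : ℝ) : ℂ) := by
  have hpi := Real.pi_pos
  have hm : 0 < (k : ℝ) + 1 := by positivity
  have hsq : (2 * Real.pi * x / a) ^ 2 = (2 * Real.pi * (k + 1) / a) ^ 2 := by
    rcases hx with h | h <;> rw [h]
    ring
  rw [ft_L a ha x _ (by rw [hsq]; exact alt_sum (2 * Real.pi * (k + 1) / a) (by positivity))]
  congr 1
  unfold cc
  have e : Real.pi * (2 * Real.pi * (k + 1) / a) = 2 * ((k : ℝ) + 1) * Real.pi ^ 2 / a := by ring
  rw [e]
  have : 0 < Real.sinh (2 * ((k : ℝ) + 1) * Real.pi ^ 2 / a) :=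
      Real.sinh_pos_iff.mpr (by positivity)
  generalize Real.sinh (2 * ((k : ℝ) + 1) * Real.pi ^ 2 / a) = z at *
  generalize (k : ℝ) + 1 = m at *
  field_simp

set_option maxHeartbeats 400000 in
open FourierTransform in
lemma poisson_L (a : ℝ) (ha : 0 < a) (t : ℝ) (h0 : 0 ≤ t) (h1 : t ≤ 1) :
    UU a (-t) + UU a (t - 1) = Real.pi ^ 2 / (6 * a) +
      ∑' k : ℕ, cc a k * Real.cos (2 * ((k : ℝ) + 1) * Real.pi * t) := by
  set f : ℝ → ℂ := fun x : ℝ => ((Real.log (1 + Real.exp (-a * |x|)) : ℝ) : ℂ) with hf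
  have hcont : Continuous f := by
    apply Complex.continuous_ofReal.comp
    apply Continuous.log
    · fun_prop
    · intro x; positivity
  have hp : ∀ k : ℕ, 𝓕 f (((k : ℤ) + 1 : ℤ) : ℝ) = ((cc a k / 2 : ℝ) : ℂ) := fun k =>
    ft_ne a ha k _ (Or.inl (by push_cast; rfl))
  have hn : ∀ k : ℕ, 𝓕 f ((-((k : ℤ) + 1) : ℤ) : ℝ) = ((cc a k / 2 : ℝ) : ℂ) := fun k =>
    ft_ne a ha k _ (Or.inr (by push_cast; rfl))
  have hz : 𝓕 f ((0 : ℤ) : ℝ) = ((Real.pi ^ 2 / (6 * a) : ℝ) : ℂ) := by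
    rw [Int.cast_zero]; exact ft_zero a ha
  have hsc : Summable (fun k => ((cc a k / 2 : ℝ) : ℂ)) :=
    Complex.summable_ofReal.mpr ((sum_cc a ha).div_const 2)
  have hFs : Summable fun n : ℤ => 𝓕 f n := by
    apply Summable.of_add_one_of_neg_add_one
    · simp_rw [hp]; exact hsc
    · simp_rw [hn]; exact hsc
  have hP := Real.tsum_eq_tsum_fourier_of_rpow_decay_of_summable hcont one_lt_two (L_decay a ha) hFs t
  have hl1 : ∀ n : ℕ, f (t + ((n : ℤ) : ℝ)) = ((Real.log (1 + Real.exp (a * (-t - n))) : ℝ) : ℂ) := by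
    intro n
    simp only [hf, Int.cast_natCast]
    rw [abs_of_nonneg (by positivity)]
    congr 4; ring
  have hl2 : ∀ n : ℕ, f (t + ((-((n : ℤ) + 1) : ℤ) : ℝ)) =
      ((Real.log (1 + Real.exp (a * (t - 1 - n))) : ℝ) : ℂ) := by
    intro n
    simp only [hf]
    push_cast
    rw [abs_of_nonpos (by linarith [(Nat.cast_nonneg n : (0 : ℝ) ≤ n)])]
    congr 4; ring
  have hq1 : Summable (fun n : ℕ => f (t + ((n : ℤ) : ℝ))) := by
    simp_rw [hl1]; exact Complex.summable_ofReal.mpr (UU_summable a (-t) ha)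
  have hq2 : Summable (fun n : ℕ => f (t + ((-((n : ℤ) + 1) : ℤ) : ℝ))) := by
    simp_rw [hl2]; exact Complex.summable_ofReal.mpr (UU_summable a (t - 1) ha)
  rw [tsum_of_nat_of_neg_add_one (f := fun n : ℤ => f (t + (n : ℝ))) hq1 hq2] at hP
  simp_rw [hl1, hl2] at hP
  rw [← Complex.ofReal_tsum, ← Complex.ofReal_tsum] at hP
  have hb : ∀ n : ℤ, ‖fourier n (t : UnitAddCircle)‖ = 1 := by
    intro n
    rw [fourier_apply]; exact Circle.norm_coe _
  have hs1 : Summable fun n : ℕ => 𝓕 f (((n : ℤ) + 1 : ℤ) : ℝ) * fourier ((n : ℤ) + 1) (t : UnitAddCircle) := by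
    apply Summable.of_norm
    simp_rw [norm_mul, hb, mul_one, hp]; exact hsc.norm
  have hs2 : Summable fun n : ℕ => 𝓕 f ((-((n : ℤ) + 1) : ℤ) : ℝ) * fourier (-((n : ℤ) + 1)) (t : UnitAddCircle) := by
    apply Summable.of_norm
    simp_rw [norm_mul, hb, mul_one, hn]; exact hsc.norm
  rw [tsum_of_add_one_of_neg_add_one
    (f := fun n : ℤ => 𝓕 f (n : ℝ) * fourier n (t : UnitAddCircle)) hs1 hs2, add_right_comm, ← hs1.tsum_add hs2, hz] at hP
  have hcos : ∀ k : ℕ, 𝓕 f (((k : ℤ) + 1 : ℤ) : ℝ) * fourier ((k : ℤ) + 1) (t : UnitAddCircle) +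
      𝓕 f ((-((k : ℤ) + 1) : ℤ) : ℝ) * fourier (-((k : ℤ) + 1)) (t : UnitAddCircle) =
      ((cc a k * Real.cos (2 * ((k : ℝ) + 1) * Real.pi * t) : ℝ) : ℂ) := by
    intro k
    rw [hp, hn, fourier_coe_apply, fourier_coe_apply]
    push_cast
    rw [Complex.cos]
    have e1 : 2 * (Real.pi : ℂ) * Complex.I * (k + 1) * t / 1 = 2 * (k + 1) * Real.pi * t * Complex.I := by ring
    have e2 : 2 * (Real.pi : ℂ) * Complex.I * (-1 + -k) * t / 1 = -(2 * (k + 1) * Real.pi * t) * Complex.I := by ring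
    have e3 : 2 * (Real.pi : ℂ) * Complex.I * -(k + 1) * t / 1 = -(2 * (k + 1) * Real.pi * t) * Complex.I := by ring
    simp only [e1, e2, e3]
    ring
  simp_rw [hcos] at hP
  rw [← Complex.ofReal_tsum, fourier_zero, mul_one, ← Complex.ofReal_add, ← Complex.ofReal_add] at hP
  have := Complex.ofReal_injective hP
  unfold UU
  rw [this, add_comm]

lemma bern (t : ℝ) (h0 : 0 ≤ t) (h1 : t ≤ 1) :
    HasSum (fun k : ℕ => 1 / ((k : ℝ) + 1) ^ 2 * Real.cos (2 * ((k : ℝ) + 1) * Real.pi * t))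
      (Real.pi ^ 2 * (t ^ 2 - t + 1 / 6)) := by
  have h := hasSum_one_div_nat_pow_mul_cos (k := 1) one_ne_zero (x := t) ⟨h0, h1⟩
  have h2 := (hasSum_nat_add_iff' 1).mpr h
  have hB : (Polynomial.map (algebraMap ℚ ℝ) (Polynomial.bernoulli (2 * 1))).eval t = t ^ 2 - t + 1 / 6 := by
    simp [Polynomial.bernoulli, Finset.sum_range_succ, bernoulli_eq_bernoulli'_of_ne_one,
      bernoulli_one, bernoulli'_two]
    ring
  rw [hB] at h2
  have e1 : (fun k : ℕ => 1 / ((k : ℝ) + 1) ^ 2 * Real.cos (2 * ((k : ℝ) + 1) * Real.pi * t)) =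
      fun n : ℕ => 1 / ((n + 1 : ℕ) : ℝ) ^ (2 * 1) * Real.cos (2 * Real.pi * ((n + 1 : ℕ) : ℝ) * t) := by
    funext k
    push_cast
    rw [show 2 * ((k : ℝ) + 1) * Real.pi * t = 2 * Real.pi * ((k : ℝ) + 1) * t by ring]
  rw [e1]
  convert! h2 using 1
  simp only [Finset.range_one, Finset.sum_singleton, Nat.cast_zero, mul_one]
  norm_num
  left; ring

lemma base_id (t : ℝ) (h0 : 0 ≤ t) (h1 : t ≤ 1) :
    UU (Real.log 2) t + UU (Real.log 2) (-1 - t) =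
      Real.log 2 * t / 2 + Real.log 2 * t ^ 2 / 2 + P t := by
  have ha : 0 < Real.log 2 := Real.log_pos one_lt_two
  set a := Real.log 2 with hadef
  have hp := poisson_L a ha t h0 h1
  have hb := (bern t h0 h1).mul_left (a / (2 * Real.pi ^ 2))
  have hsc : Summable (fun j : ℕ => Real.cos (2 * ((j:ℝ)+1) * Real.pi * t) /
      (((j:ℝ)+1) * Real.sinh (2 * ((j:ℝ)+1) * Real.pi^2 / a))) := by
    refine Summable.of_norm_bounded (sum_sinh a ha) (fun k => ?_)
    have hs : 0 < Real.sinh (2 * ((k : ℝ) + 1) * Real.pi ^ 2 / a) :=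
      Real.sinh_pos_iff.mpr (by have := Real.pi_pos; positivity)
    rw [norm_div, Real.norm_of_nonneg (r := ((k : ℝ) + 1) * _) (by positivity)]
    gcongr
    exact Real.abs_cos_le_one _
  have hd := hb.sub hsc.hasSum
  have he : ∑' k : ℕ, cc a k * Real.cos (2 * ((k : ℝ) + 1) * Real.pi * t) =
      a / (2 * Real.pi ^ 2) * (Real.pi ^ 2 * (t ^ 2 - t + 1 / 6)) -
      ∑' j : ℕ, Real.cos (2 * ((j:ℝ)+1) * Real.pi * t) /
      (((j:ℝ)+1) * Real.sinh (2 * ((j:ℝ)+1) * Real.pi^2 / a)) := by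
    rw [← hd.tsum_eq]
    apply tsum_congr
    intro k
    unfold cc
    ring
  rw [he] at hp
  have hu1 := UU_succ a (t - 1) ha
  have hu2 := UU_succ a (-1 - t) ha
  rw [sub_add_cancel] at hu1
  rw [show -1 - t + 1 = -t by ring] at hu2
  have hl : Real.log (1 + Real.exp (a * t)) = a * t + Real.log (1 + Real.exp (a * -t)) := by
    have : 1 + Real.exp (a * t) = Real.exp (a * t) * (1 + Real.exp (a * -t)) := by
      rw [mul_add, ← Real.exp_add]; simp [add_comm]
    rw [this, Real.log_mul (by positivity) (by positivity), Real.log_exp]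
  have hpi : a / (2 * Real.pi ^ 2) * (Real.pi ^ 2 * (t ^ 2 - t + 1 / 6)) = a / 2 * (t ^ 2 - t + 1 / 6) := by
    field_simp
  rw [hpi] at hp
  unfold P
  rw [← hadef]
  linarith

lemma P_per (t : ℝ) : P (t + 1) = P t := by
  unfold P
  congr 1
  apply tsum_congr
  intro j
  congr 1
  rw [← Real.cos_add_nat_mul_two_pi (2 * ((j:ℝ)+1) * Real.pi * t) (j + 1)]
  congr 1
  push_cast
  ring

lemma step_id (t : ℝ) : (UU (Real.log 2) t + UU (Real.log 2) (-1 - t) =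
      Real.log 2 * t / 2 + Real.log 2 * t ^ 2 / 2 + P t) ↔
    (UU (Real.log 2) (t + 1) + UU (Real.log 2) (-1 - (t + 1)) =
      Real.log 2 * (t + 1) / 2 + Real.log 2 * (t + 1) ^ 2 / 2 + P (t + 1)) := by
  have ha : 0 < Real.log 2 := Real.log_pos one_lt_two
  set a := Real.log 2 with hadef
  rw [P_per]
  have hu1 := UU_succ a t ha
  have hu2 := UU_succ a (-1 - (t + 1)) ha
  rw [show -1 - (t + 1) + 1 = -1 - t by ring] at hu2
  have hl : Real.log (1 + Real.exp (a * (t + 1))) =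
      a * (t + 1) + Real.log (1 + Real.exp (a * (-1 - t))) := by
    have : 1 + Real.exp (a * (t + 1)) = Real.exp (a * (t + 1)) * (1 + Real.exp (a * (-1 - t))) := by
      rw [mul_add (Real.exp _), ← Real.exp_add, show a * (t + 1) + a * (-1 - t) = 0 by ring]; simp [add_comm]
    rw [this, Real.log_mul (by positivity) (by positivity), Real.log_exp]
  rw [hu1, hu2, hl]
  constructor <;> intro h <;> linarith

lemma full_id (t : ℝ) : UU (Real.log 2) t + UU (Real.log 2) (-1 - t) =
      Real.log 2 * t / 2 + Real.log 2 * t ^ 2 / 2 + P t := by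
  have key : ∀ n : ℤ, ∀ u : ℝ, 0 ≤ u → u ≤ 1 →
      UU (Real.log 2) (u + n) + UU (Real.log 2) (-1 - (u + n)) =
      Real.log 2 * (u + n) / 2 + Real.log 2 * (u + n) ^ 2 / 2 + P (u + n) := by
    intro n u h0 h1
    induction n using Int.induction_on with
    | zero => simpa using base_id u h0 h1
    | succ k ih =>
      have := (step_id _).mp ih
      rw [add_assoc] at this
      push_cast at this ⊢
      exact this
    | pred k ih =>
      apply (step_id _).mpr
      push_cast at ih ⊢
      rw [show u + (-(k : ℝ) - 1) + 1 = u + -(k : ℝ) by ring]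
      exact ih
  have := key ⌊t⌋ (Int.fract t) (Int.fract_nonneg t) (Int.fract_lt_one t).le
  rwa [Int.fract_add_floor] at this
/-- For `s > 0`:
`∏_{j≥0}(1 + 2^{−j}s) = √s · exp((log s)²/(2 log 2) + P(log₂ s)) · ∏_{j≥1} 1/(1 + 2^{−j}/s)`,
with both infinite products convergent. -/
theorem Q_product_identity : ∀ s : ℝ, 0 < s →
    Multipliable (fun j : ℕ => 1 + (2:ℝ)^(-(j:ℤ)) * s) ∧
    Multipliable (fun j : ℕ => (1 + (2:ℝ)^(-(j:ℤ)-1) / s)⁻¹) ∧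
    ∏' j : ℕ, (1 + (2:ℝ)^(-(j:ℤ)) * s) =
      Real.sqrt s * Real.exp ((Real.log s)^2 / (2 * Real.log 2) + P (Real.logb 2 s)) *
        ∏' j : ℕ, (1 + (2:ℝ)^(-(j:ℤ)-1) / s)⁻¹ := by
  intro s hs
  have ha : 0 < Real.log 2 := Real.log_pos one_lt_two
  set t := Real.logb 2 s with ht
  have hat : Real.log 2 * t = Real.log s := by
    rw [ht, Real.logb]; field_simp
  have hz : ∀ n : ℤ, (2 : ℝ) ^ n = Real.exp (Real.log 2 * n) := by
    intro n
    rw [← Real.rpow_intCast, Real.rpow_def_of_pos two_pos]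
  have e1 : ∀ j : ℕ, 1 + (2:ℝ)^(-(j:ℤ)) * s = 1 + Real.exp (Real.log 2 * (t - j)) := by
    intro j
    rw [hz]
    nth_rewrite 1 [← Real.exp_log hs]
    rw [← hat, ← Real.exp_add]
    congr 2; push_cast; ring
  have e2 : ∀ j : ℕ, 1 + (2:ℝ)^(-(j:ℤ)-1) / s = 1 + Real.exp (Real.log 2 * (-1 - t - j)) := by
    intro j
    rw [hz]
    nth_rewrite 1 [← Real.exp_log hs]
    rw [← hat, ← Real.exp_sub]
    congr 2; push_cast; ring
  simp_rw [e1, e2]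
  have s1 := UU_summable (Real.log 2) t ha
  have s2 := UU_summable (Real.log 2) (-1 - t) ha
  have s3 : Summable (fun j : ℕ => Real.log (1 + Real.exp (Real.log 2 * (-1 - t - j)))⁻¹) := by
    simp_rw [Real.log_inv]; exact s2.neg
  refine ⟨Real.multipliable_of_summable_log (fun j => by positivity) s1,
    Real.multipliable_of_summable_log (fun j => by positivity) s3, ?_⟩
  rw [← Real.rexp_tsum_eq_tprod (fun j => by positivity) s1,
    ← Real.rexp_tsum_eq_tprod (fun j => by positivity) s3]
  simp_rw [Real.log_inv]
  rw [tsum_neg]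
  have hf := full_id t
  unfold UU at hf
  have hsq : Real.sqrt s = Real.exp (Real.log s / 2) := by
    rw [Real.exp_half, Real.exp_log hs]
  rw [hsq, ← Real.exp_add, ← Real.exp_add]
  congr 1
  have h3 : Real.log s ^ 2 / (2 * Real.log 2) = Real.log 2 * t ^ 2 / 2 := by
    rw [← hat]; field_simp
  rw [h3, ← hat]
  linarith
end

section
/- There exist constants C > 0 and s₀ ≥ 1 such that for all real s ≥ s₀, the Laplace transform of G satisfies |(∫_0^∞ e^{−sx} G(x) dx) · (∏_{j≥0} (1 + 2^{−j} s))/2 − 1| ≤ C/s. (That is, ∫_0^∞ e^{−sx} G(x) dx = (2/∏_{j≥0}(1 + 2^{−j}s))(1 + O(1/s)) as s → ∞.) -/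
open Filter Real

/-- `Q j = ∏_{ℓ=1}^{j} (1 - 2^{-ℓ})`. -/
noncomputable def Q (j : ℕ) : ℝ := ∏ l ∈ Finset.range j, (1 - (2:ℝ)^(-(l:ℤ)-1))

/-- `Q_∞ = ∏_{ℓ≥1} (1 - 2^{-ℓ})`. -/
noncomputable def Qinf : ℝ := ∏' l : ℕ, (1 - (2:ℝ)^(-(l:ℤ)-1))

/-- `φ(u,v;x) = e^{-ux} ∫_0^x t e^{(u-v)t} dt`. -/
noncomputable def phi (u v x : ℝ) : ℝ :=
  Real.exp (-u * x) * ∫ t in (0:ℝ)..x, t * Real.exp ((u - v) * t)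

/-- The function `G` describing the asymptotic variance of the external profile. -/
noncomputable def G (x : ℝ) : ℝ :=
  ∑' j : ℕ, ∑' r : ℕ, ∑ h ∈ Finset.range (j+1), ∑ l ∈ Finset.range (j+1),
    (-1:ℝ)^(r+h+l) *
      (2:ℝ)^(-(j:ℤ) - (r.choose 2 : ℤ) - (h.choose 2 : ℤ) - (l.choose 2 : ℤ)
        + 2*(h:ℤ) + 2*(l:ℤ)) *
      phi ((2:ℝ)^(r+j)) ((2:ℝ)^h + (2:ℝ)^l) x /
      (Qinf * Q r * Q h * Q (j-h) * Q l * Q (j-l))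

/-- The Laplace transform of `G` satisfies
`∫_0^∞ e^{−sx} G(x) dx = (2/∏_{j≥0}(1 + 2^{−j}s))(1 + O(1/s))` as `s → ∞`. -/

lemma Q_succ (j : ℕ) : Q (j+1) = Q j * (1 - (1/2:ℝ)^(j+1)) := by
  unfold Q
  rw [Finset.prod_range_succ]
  congr 2
  rw [show (-(j:ℤ)-1) = -((j+1:ℕ):ℤ) by push_cast; ring, zpow_neg, zpow_natCast]
  simp

lemma Q_zero : Q 0 = 1 := by simp [Q]

lemma Q_lb_aux (j : ℕ) : 1/4 + (1/2:ℝ)^(j+2) ≤ Q (j+1) := by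
  induction j with
  | zero => rw [Q_succ, Q_zero]; norm_num
  | succ n ih =>
    rw [Q_succ]
    have h0 : (0:ℝ) < (1/2:ℝ)^n := by positivity
    have h1 : (1/2:ℝ)^n ≤ 1 := pow_le_one₀ (by norm_num) (by norm_num)
    have e1 : (1/2:ℝ)^(n+2) = (1/2:ℝ)^n/4 := by rw [pow_succ, pow_succ]; ring
    have e2 : (1/2:ℝ)^(n+1+1) = (1/2:ℝ)^n/4 := by rw [pow_succ, pow_succ]; ring
    have e3 : (1/2:ℝ)^(n+1+2) = (1/2:ℝ)^n/8 := by rw [pow_succ, pow_succ, pow_succ]; ring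
    rw [e1] at ih
    rw [e2, e3]
    nlinarith

lemma Q_lb (j : ℕ) : 1/4 ≤ Q j := by
  cases j with
  | zero => rw [Q_zero]; norm_num
  | succ n =>
    have := Q_lb_aux n
    have : (0:ℝ) < (1/2:ℝ)^(n+2) := by positivity
    linarith

lemma Q_pos (j : ℕ) : 0 < Q j := by linarith [Q_lb j]

lemma Q_tendsto : Tendsto Q atTop (nhds Qinf) := by
  have : Multipliable (fun l : ℕ => (1 - (2:ℝ)^(-(l:ℤ)-1))) := by
    have := multipliable_one_add_of_summable (f := fun l : ℕ => -(2:ℝ)^(-(l:ℤ)-1)) (by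
      have hs : Summable (fun l : ℕ => (1/2:ℝ)^l * (1/2)) :=
        (summable_geometric_of_lt_one (by norm_num) (by norm_num)).mul_right _
      refine hs.congr fun l => ?_
      rw [norm_neg, Real.norm_of_nonneg (by positivity), zpow_sub₀ (by norm_num), zpow_neg,
        zpow_natCast]
      simp [div_eq_mul_inv])
    simpa [sub_eq_add_neg] using this
  exact this.tendsto_prod_tprod_nat

lemma Qinf_lb : 1/4 ≤ Qinf := ge_of_tendsto' Q_tendsto Q_lb

lemma Qinf_pos : 0 < Qinf := by linarith [Qinf_lb]

/-- partial fraction coefficients -/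
noncomputable def bq (j h : ℕ) : ℝ := (-1)^h * (1/2)^(h.choose 2) / (Q h * Q (j-h))

lemma bq_rec1 (j h : ℕ) (hh : h ≤ j) :
    ((2:ℝ)^(j+1) - 2^h) * bq (j+1) h = 2^(j+1) * bq j h := by
  obtain ⟨d, rfl⟩ := Nat.exists_eq_add_of_le hh
  unfold bq
  rw [show h + d + 1 - h = d+1 by omega, show h + d - h = d by omega, Q_succ]
  have h1 := (Q_pos h).ne'
  have h2 := (Q_pos d).ne'
  have h3 : (1 - (1/2:ℝ)^(d+1)) ≠ 0 := by
    have : (1/2:ℝ)^(d+1) < 1 := pow_lt_one₀ (by norm_num) (by norm_num) (by omega)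
    linarith
  have h4 : ((2:ℝ)^(h+d+1) - 2^h) = 2^(h+d+1) * (1 - (1/2:ℝ)^(d+1)) := by
    have : (2:ℝ)^(d+1) * (1/2)^(d+1) = 1 := by rw [← mul_pow]; norm_num
    rw [add_assoc, pow_add]
    linear_combination (2:ℝ)^h * this
  rw [h4]
  field_simp

lemma bq_rec (j : ℕ) (f : ℕ → ℝ) :
    ∑ h ∈ Finset.range (j+2), ((2:ℝ)^(j+1) - 2^h) * bq (j+1) h * f h =
      2^(j+1) * ∑ h ∈ Finset.range (j+1), bq j h * f h := by
  rw [Finset.sum_range_succ, sub_self, zero_mul, zero_mul, add_zero, Finset.mul_sum]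
  refine Finset.sum_congr rfl fun h hh => ?_
  rw [bq_rec1 j h (by simpa [Nat.lt_succ_iff] using hh)]
  ring

lemma bq_partial (j n : ℕ) (hn : n ≤ j) :
    ∑ h ∈ Finset.range (n+1), bq (j+1) h * (1 - (1/2)^(j+1)) =
      (-1)^n * (1/2)^((n+1).choose 2) / (Q n * Q (j-n)) := by
  induction n with
  | zero =>
    simp only [zero_add, Finset.range_one, Finset.sum_singleton, bq, Nat.sub_zero, Q_zero, Q_succ]
    have h2 := (Q_pos j).ne'
    have h3 : (1 - (1/2:ℝ)^(j+1)) ≠ 0 := by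
      have : (1/2:ℝ)^(j+1) < 1 := pow_lt_one₀ (by norm_num) (by norm_num) (by omega)
      linarith
    simp only [Nat.choose_zero_succ, pow_zero]
    norm_num
    field_simp
  | succ n ih =>
    rw [Finset.sum_range_succ, ih (by omega)]
    obtain ⟨d, rfl⟩ := Nat.exists_eq_add_of_le hn
    unfold bq
    rw [show n + 1 + d - n = d + 1 by omega, show n + 1 + d + 1 - (n+1) = d + 1 by omega,
      show n + 1 + d - (n+1) = d by omega]
    have hc : (n+1+1).choose 2 = (n+1) + (n+1).choose 2 := by
      rw [Nat.choose_succ_succ' (n+1) 1, Nat.choose_one_right]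
    rw [hc, Q_succ n, Q_succ d]
    have h1 := (Q_pos n).ne'
    have h2 := (Q_pos d).ne'
    have h3 : (1 - (1/2:ℝ)^(d+1)) ≠ 0 := by
      have : (1/2:ℝ)^(d+1) < 1 := pow_lt_one₀ (by norm_num) (by norm_num) (by omega)
      linarith
    have h4 : (1 - (1/2:ℝ)^(n+1)) ≠ 0 := by
      have : (1/2:ℝ)^(n+1) < 1 := pow_lt_one₀ (by norm_num) (by norm_num) (by omega)
      linarith
    rw [show n + 1 + d + 1 = (n+1)+(d+1) by ring, pow_add (1/2:ℝ) (n+1) (d+1),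
      pow_add (1/2:ℝ) (n+1) ((n+1).choose 2), pow_succ (-1:ℝ) n]
    generalize (1/2:ℝ)^(n+1) = x at *
    generalize (1/2:ℝ)^(d+1) = y at *
    generalize (1/2:ℝ)^((n+1).choose 2) = z at *
    field_simp
    ring

lemma m0 (j : ℕ) : ∑ h ∈ Finset.range (j+2), bq (j+1) h = 0 := by
  have h3 : (1 - (1/2:ℝ)^(j+1)) ≠ 0 := by
    have : (1/2:ℝ)^(j+1) < 1 := pow_lt_one₀ (by norm_num) (by norm_num) (by omega)
    linarith
  have := bq_partial j j le_rfl
  have h5 : (∑ h ∈ Finset.range (j+2), bq (j+1) h) * (1 - (1/2)^(j+1)) = 0 := by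
    rw [Finset.sum_mul, Finset.sum_range_succ, this]
    unfold bq
    rw [Nat.sub_self, Nat.sub_self, Q_zero, Q_succ j]
    have h1 := (Q_pos j).ne'
    rw [pow_succ (-1:ℝ) j]
    field_simp
    ring
  rcases mul_eq_zero.1 h5 with h | h
  · exact h
  · exact absurd h h3

lemma m1 (j : ℕ) : ∑ h ∈ Finset.range (j+3), bq (j+2) h * 2^h = 0 := by
  have := bq_rec (j+1) (fun _ => 1)
  simp only [mul_one, m0, mul_zero, sub_mul, Finset.sum_sub_distrib, ← Finset.mul_sum,
    zero_sub, m0 (j+1)] at this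
  have h := m0 (j+1)
  simp only [add_assoc] at this h
  norm_num at this h
  exact (Finset.sum_congr rfl fun _ _ => mul_comm _ _).trans this

lemma m2 (j : ℕ) : ∑ h ∈ Finset.range (j+4), bq (j+3) h * 4^h = 0 := by
  have := bq_rec (j+2) (fun h => 2^h)
  rw [m1 j, mul_zero] at this
  have h := m1 (j+1)
  have e : ∀ h, ((2:ℝ)^(j+2+1) - 2^h) * bq (j+2+1) h * 2^h =
    2^(j+3) * (bq (j+3) h * 2^h) - bq (j+3) h * 4^h := by
    intro h
    rw [show (4:ℝ) = 2*2 by norm_num, mul_pow]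
    ring
  simp only [e, Finset.sum_sub_distrib, ← Finset.mul_sum] at this
  rw [show j + 1 + 3 = j + 2 + 2 by ring, show j+1+2 = j+3 by ring] at h
  rw [h] at this
  have e2 : j + 4 = j + 2 + 2 := by ring
  rw [e2]
  linarith

/-- finite partial fractions -/
lemma pf_fin (s : ℝ) (hs : 0 < s) (j : ℕ) :
    (∑ h ∈ Finset.range (j+1), bq j h * (1 / (s + 2^h))) *
      ∏ i ∈ Finset.range (j+1), (1 + (1/2)^i * s) = 1 := by
  induction j with
  | zero =>
    simp [bq, Q_zero]
    field_simp
    ring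
  | succ j ih =>
    have := bq_rec j (fun h => 1 / (s + 2^h))
    have e : ∀ h, ((2:ℝ)^(j+1) - 2^h) * bq (j+1) h * (1 / (s + 2^h)) =
      (2^(j+1) + s) * (bq (j+1) h * (1 / (s + 2^h))) - bq (j+1) h := by
      intro h
      have : s + 2^h ≠ 0 := by positivity
      field_simp
      ring
    simp only [e, Finset.sum_sub_distrib, ← Finset.mul_sum, m0, sub_zero] at this
    rw [Finset.prod_range_succ _ (j+1)]
    have h2 : (2:ℝ)^(j+1) * (1/2)^(j+1) = 1 := by rw [← mul_pow]; norm_num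
    generalize ∑ h ∈ Finset.range (j+1+1), bq (j+1) h * (1 / (s + 2^h)) = X at *
    generalize ∑ h ∈ Finset.range (j+1), bq j h * (1 / (s + 2^h)) = Y at *
    generalize ∏ i ∈ Finset.range (j+1), (1 + (1/2)^i * s) = Z at *
    linear_combination (1/2)^(j+1) * Z * this + (Y * Z - X * Z) * h2 + ih

noncomputable def PP (s : ℝ) : ℝ := ∏' j : ℕ, (1 + (2:ℝ)^(-(j:ℤ)) * s)

lemma PP_tendsto (s : ℝ) :
    Tendsto (fun n => ∏ i ∈ Finset.range n, (1 + (1/2:ℝ)^i * s)) atTop (nhds (PP s)) := by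
  have e : ∀ j : ℕ, (2:ℝ)^(-(j:ℤ)) = (1/2)^j := by
    intro j
    rw [zpow_neg, zpow_natCast]; simp
  unfold PP
  simp only [e]
  refine (multipliable_one_add_of_summable ?_).tendsto_prod_tprod_nat
  exact ((summable_geometric_of_lt_one (by norm_num) (by norm_num)).mul_right s).norm

lemma PP_split (s : ℝ) (j : ℕ) :
    PP s = (∏ i ∈ Finset.range j, (1 + (1/2:ℝ)^i * s)) * PP ((1/2)^j * s) := by
  have h1 := (PP_tendsto ((1/2)^j * s)).const_mul (∏ i ∈ Finset.range j, (1 + (1/2:ℝ)^i * s))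
  have h2 := (PP_tendsto s).comp (tendsto_add_atTop_nat j)
  refine tendsto_nhds_unique h2 (h1.congr fun n => ?_)
  simp only [Function.comp]
  rw [add_comm n j, Finset.prod_range_add]
  congr 1
  refine Finset.prod_congr rfl fun i _ => ?_
  rw [pow_add]; ring

lemma PP_ge (s : ℝ) (hs : 0 ≤ s) : 1 ≤ PP s := by
  refine ge_of_tendsto' (PP_tendsto s) fun n => ?_
  refine Finset.prod_induction _ (fun x : ℝ => 1 ≤ x) (fun a b ha hb => ?_) le_rfl (fun i _ => ?_)
  · nlinarith
  have : 0 ≤ (1/2:ℝ)^i * s := by positivity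
  linarith

lemma choose_bd (h : ℕ) : 3 * h ≤ h.choose 2 + 6 := by
  rcases lt_or_ge h 3 with h3 | h3
  · omega
  · induction h, h3 using Nat.le_induction with
    | base => decide
    | succ n hn ih =>
      have := Nat.choose_succ_succ' n 1
      rw [Nat.choose_one_right] at this
      norm_num at this
      omega

lemma half_choose (h : ℕ) : (1/2:ℝ)^(h.choose 2) ≤ 64 * (1/8)^h := by
  have h1 : (1/2:ℝ)^(h.choose 2 + 6) ≤ (1/2)^(3*h) :=
    pow_le_pow_of_le_one (by norm_num) (by norm_num) (choose_bd h)
  rw [pow_add, pow_mul] at h1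
  norm_num at h1 ⊢
  linarith

noncomputable def beta (r : ℕ) : ℝ := (-1)^r * (1/2)^(r.choose 2) / (Qinf * Q r)

lemma quot_bd (h : ℕ) (x y : ℝ) (hx : 1/4 ≤ x) (hy : 1/4 ≤ y) :
    |(-1)^h * (1/2:ℝ)^(h.choose 2) / (x * y)| ≤ 1024 * (1/8)^h := by
  have hxy : 1/16 ≤ x * y := by nlinarith
  rw [abs_div, abs_mul, abs_pow, abs_neg, abs_one, one_pow, one_mul,
    abs_of_pos (show (0:ℝ) < (1/2)^(h.choose 2) by positivity), abs_of_pos (by linarith),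
    div_le_iff₀ (by linarith)]
  have h8 : (0:ℝ) < (1/8)^h := by positivity
  have := half_choose h
  nlinarith

lemma bq_bd (j h : ℕ) : |bq j h| ≤ 1024 * (1/8)^h := quot_bd _ _ _ (Q_lb _) (Q_lb _)

lemma beta_bd (r : ℕ) : |beta r| ≤ 1024 * (1/8)^r := quot_bd _ _ _ Qinf_lb (Q_lb _)

lemma sum8 : Summable (fun r : ℕ => 1024 * (1/8:ℝ)^r) :=
  (summable_geometric_of_lt_one (by norm_num) (by norm_num)).mul_left _

lemma pf_inf (s : ℝ) (hs : 0 < s) : (∑' r, beta r * (1 / (s + 2^r))) * PP s = 1 := by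
  have key : Tendsto (fun j : ℕ => ∑' h, (if h ∈ Finset.range (j+1) then
      bq j h * (1 / (s + 2^h)) else 0)) atTop (nhds (∑' r, beta r * (1 / (s + 2^r)))) := by
    refine tendsto_tsum_of_dominated_convergence sum8 (fun h => ?_) (Eventually.of_forall fun j h => ?_)
    · have h1 : Tendsto (fun j => bq j h * (1 / (s + 2^h))) atTop
          (nhds (beta h * (1 / (s + 2^h)))) := by
        refine Tendsto.mul_const _ ?_
        unfold bq beta
        rw [mul_comm Qinf]
        have := (Q_pos h).ne'
        have := Qinf_pos.ne'
        refine Tendsto.div tendsto_const_nhds (Tendsto.const_mul _ ?_) (by positivity)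
        exact Q_tendsto.comp (tendsto_sub_atTop_nat h)
      refine h1.congr' ?_
      filter_upwards [eventually_ge_atTop h] with j hj
      rw [if_pos (by simp; omega)]
    · split_ifs
      · rw [norm_mul, Real.norm_eq_abs]
        have h1 : ‖1 / (s + 2^h)‖ ≤ 1 := by
          have : (1:ℝ) ≤ 2^h := one_le_pow₀ (by norm_num)
          rw [Real.norm_of_nonneg (by positivity), div_le_one (by positivity)]
          linarith
        calc _ ≤ |bq j h| * 1 := by gcongr
          _ ≤ _ := by rw [mul_one]; exact bq_bd j h
      · simp
  have h2 := key.mul ((PP_tendsto s).comp (tendsto_add_atTop_nat 1))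
  refine tendsto_nhds_unique h2 (tendsto_const_nhds.congr fun j => ?_)
  refine (pf_fin s hs j).symm.trans ?_
  rw [tsum_eq_sum (s := Finset.range (j+1))]
  · simp only [Function.comp]
    congr 1
    refine Finset.sum_congr rfl fun h hh => by rw [if_pos hh]
  · intro b hb
    rw [if_neg hb]

lemma pf_shift (s : ℝ) (hs : 0 < s) (j : ℕ) :
    (∑' r, beta r * (1 / (s + 2^(r+j)))) * PP s =
      (1/2)^j * ∏ i ∈ Finset.range j, (1 + (1/2:ℝ)^i * s) := by
  have h := pf_inf ((1/2)^j * s) (by positivity)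
  rw [PP_split s j]
  have e : ∀ r : ℕ, beta r * (1 / (s + 2^(r+j))) =
      (1/2)^j * (beta r * (1 / ((1/2)^j * s + 2^r))) := by
    intro r
    have h1 : (2:ℝ)^j * (1/2)^j = 1 := by rw [← mul_pow]; norm_num
    have h2 : s + 2^(r+j) = 2^j * ((1/2)^j * s + 2^r) := by
      rw [pow_add]; linear_combination -s * h1
    rw [h2, one_div ((2:ℝ)^j * _), mul_inv]
    have : ((2:ℝ)^j)⁻¹ = (1/2)^j := by simp
    rw [this, one_div ((1/2)^j * s + 2^r)]
    ring
  simp only [e, tsum_mul_left]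
  linear_combination (1/2)^j * (∏ i ∈ Finset.range j, (1 + (1/2:ℝ)^i * s)) * h

noncomputable def aq (j h : ℕ) : ℝ := bq j h * 4^h

lemma aq_bd (j h : ℕ) : |aq j h| ≤ 1024 * (1/2)^h := by
  unfold aq
  rw [abs_mul, abs_of_pos (show (0:ℝ) < 4^h by positivity)]
  calc _ ≤ 1024 * (1/8)^h * (4:ℝ)^h := by gcongr; exact bq_bd j h
    _ = _ := by rw [mul_assoc, ← mul_pow]; norm_num

lemma aq_sum (j : ℕ) : ∑ h ∈ Finset.range (j+1), |aq j h| ≤ 2048 := by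
  calc _ ≤ ∑ h ∈ Finset.range (j+1), 1024 * (1/2:ℝ)^h := Finset.sum_le_sum fun h _ => aq_bd j h
    _ ≤ ∑' h, 1024 * (1/2:ℝ)^h := by
      refine Summable.sum_le_tsum _ (fun _ _ => by positivity) ?_
      exact summable_geometric_two.mul_left _
    _ = 2048 := by rw [tsum_mul_left, tsum_geometric_two]; norm_num

open MeasureTheory in
lemma int_pow (n : ℕ) (c : ℝ) (hc : 0 < c) :
    IntegrableOn (fun x : ℝ => x^n * Real.exp (-c * x)) (Set.Ioi 0) := by
  have h := integrableOn_rpow_mul_exp_neg_mul_rpow (p := 1) (s := n) (b := c)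
    (by have : (0:ℝ) ≤ n := Nat.cast_nonneg n
        linarith) one_pos hc
  simpa using h

lemma val_one (c : ℝ) (hc : 0 < c) :
    ∫ x in Set.Ioi (0:ℝ), x * Real.exp (-c * x) = 1 / c^2 := by
  have h := Real.integral_rpow_mul_exp_neg_mul_Ioi (a := 2) (r := c) (by norm_num) hc
  have e : (2:ℝ) - 1 = 1 := by norm_num
  simp only [e, Real.rpow_one] at h
  simp only [neg_mul]
  rw [h]
  have : Real.Gamma 2 = 1 := by
    have := Real.Gamma_nat_eq_factorial 1
    rw [show ((1:ℕ):ℝ) + 1 = 2 by norm_num] at this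
    simpa using this
  rw [this, mul_one]
  have := Real.rpow_natCast (1/c) 2
  norm_num at this ⊢

lemma phi_deriv (u v x : ℝ) : HasDerivAt (phi u v) (-u * phi u v x + x * Real.exp (-v * x)) x := by
  have h1 : HasDerivAt (fun x => ∫ t in (0:ℝ)..x, t * Real.exp ((u - v) * t))
      (x * Real.exp ((u - v) * x)) x := by
    have hc : Continuous (fun t : ℝ => t * Real.exp ((u - v) * t)) := by fun_prop
    exact intervalIntegral.integral_hasDerivAt_right (hc.intervalIntegrable _ _)
      (hc.stronglyMeasurableAtFilter _ _) hc.continuousAt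
  have h2 : HasDerivAt (fun x : ℝ => Real.exp (-u * x)) (Real.exp (-u * x) * (-u * 1)) x :=
    ((hasDerivAt_id x).const_mul (-u)).exp
  have h3 := h2.mul h1
  refine h3.congr_deriv ?_
  have e : Real.exp (-v * x) = Real.exp (-u * x) * Real.exp ((u - v) * x) := by
    rw [← Real.exp_add]; ring_nf
  rw [e]
  unfold phi
  ring

lemma phi_cont (u v : ℝ) : Continuous (phi u v) :=
  continuous_iff_continuousAt.2 fun x => (phi_deriv u v x).continuousAt

lemma phi_zero (u v : ℝ) : phi u v 0 = 0 := by simp [phi]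

lemma phi_nonneg (u v x : ℝ) (hx : 0 ≤ x) : 0 ≤ phi u v x := by
  unfold phi
  refine mul_nonneg (Real.exp_pos _).le ?_
  refine intervalIntegral.integral_nonneg hx fun t ht => ?_
  exact mul_nonneg ht.1 (Real.exp_pos _).le

lemma phi_le (u v x : ℝ) (hu : 0 ≤ u) (hv : 0 ≤ v) (hx : 0 ≤ x) : phi u v x ≤ x^2 := by
  have h1 : ∫ t in (0:ℝ)..x, t * Real.exp ((u - v) * t) ≤ ∫ t in (0:ℝ)..x, x * Real.exp (u * x) := by
    refine intervalIntegral.integral_mono_on hx ?_ ?_ fun t ht => ?_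
    · exact Continuous.intervalIntegrable (by fun_prop) _ _
    · exact Continuous.intervalIntegrable (by fun_prop) _ _
    · have h2 : (u - v) * t ≤ u * x := by nlinarith [ht.1, ht.2, mul_nonneg hv ht.1]
      have := Real.exp_le_exp.2 h2
      exact mul_le_mul ht.2 this (Real.exp_pos _).le hx
  rw [intervalIntegral.integral_const, smul_eq_mul, sub_zero] at h1
  unfold phi
  calc _ ≤ Real.exp (-u * x) * (x * (x * Real.exp (u * x))) := by gcongr
    _ = x^2 * (Real.exp (-u * x) * Real.exp (u * x)) := by ring
    _ = x^2 := by rw [← Real.exp_add]; simp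

open MeasureTheory in
lemma phi_int (u v s : ℝ) (hu : 0 ≤ u) (hv : 0 ≤ v) (hs : 0 < s) :
    IntegrableOn (fun x => Real.exp (-s * x) * phi u v x) (Set.Ioi 0) := by
  refine Integrable.mono' (int_pow 2 s hs) ?_ ?_
  · exact Continuous.aestronglyMeasurable (by have := phi_cont u v; fun_prop)
  · refine (ae_restrict_iff' measurableSet_Ioi).2 (Eventually.of_forall fun x hx => ?_)
    have hx' : (0:ℝ) ≤ x := le_of_lt hx
    rw [Real.norm_of_nonneg (mul_nonneg (Real.exp_pos _).le (phi_nonneg u v x hx')), mul_comm]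
    gcongr
    exact phi_le u v x hu hv hx'

open MeasureTheory in
lemma phi_laplace (u v s : ℝ) (hu : 0 ≤ u) (hv : 0 ≤ v) (hs : 0 < s) :
    ∫ x in Set.Ioi (0:ℝ), Real.exp (-s * x) * phi u v x = 1 / (s + u) * (1 / (s + v)^2) := by
  have hd : ∀ x ∈ Set.Ici (0:ℝ), HasDerivAt (fun x => Real.exp (-s * x) * phi u v x)
      (-(s + u) * (Real.exp (-s * x) * phi u v x) + x * Real.exp (-(s + v) * x)) x := by
    intro x _
    have h2 : HasDerivAt (fun x : ℝ => Real.exp (-s * x)) (Real.exp (-s * x) * (-s * 1)) x :=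
      ((hasDerivAt_id x).const_mul (-s)).exp
    refine (h2.mul (phi_deriv u v x)).congr_deriv ?_
    have e : Real.exp (-(s + v) * x) = Real.exp (-s * x) * Real.exp (-v * x) := by
      rw [← Real.exp_add]; ring_nf
    rw [e]; ring
  have hi1 := phi_int u v s hu hv hs
  have hi2 : IntegrableOn (fun x : ℝ => x * Real.exp (-(s + v) * x)) (Set.Ioi 0) := by
    simpa using int_pow 1 (s + v) (by linarith)
  have ht : Tendsto (fun x => Real.exp (-s * x) * phi u v x) atTop (nhds 0) := by
    have h1 : Tendsto (fun x : ℝ => (1/s^2) * ((s*x)^2 * Real.exp (-(s*x)))) atTop (nhds 0) := by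
      have := ((Real.tendsto_pow_mul_exp_neg_atTop_nhds_zero 2).comp
        (tendsto_id.const_mul_atTop hs)).const_mul (1/s^2)
      simpa using this
    refine squeeze_zero' ?_ ?_ h1
    · filter_upwards [eventually_ge_atTop 0] with x hx
      exact mul_nonneg (Real.exp_pos _).le (phi_nonneg u v x hx)
    · filter_upwards [eventually_ge_atTop 0] with x hx
      have := phi_le u v x hu hv hx
      have e : (1/s^2) * ((s*x)^2 * Real.exp (-(s*x))) = Real.exp (-s * x) * x^2 := by
        rw [neg_mul]
        field_simp
      rw [e]
      gcongr
  have h := integral_Ioi_of_hasDerivAt_of_tendsto' hd ((hi1.const_mul _).add hi2) ht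
  rw [integral_add (hi1.const_mul _) hi2, integral_const_mul, val_one _ (by linarith),
    phi_zero, mul_zero, sub_zero] at h
  have : s + u ≠ 0 := by positivity
  have h5 : (s + u) * ∫ (a : ℝ) in Set.Ioi 0, Real.exp (-s * a) * phi u v a = 1 / (s + v)^2 := by
    linarith
  rw [← h5]
  field_simp

noncomputable def AA (j : ℕ) (t : ℝ) : ℝ :=
  ∑ h ∈ Finset.range (j+1), aq j h * Real.exp (-(2:ℝ)^h * t)

noncomputable def SS (j : ℕ) (s : ℝ) : ℝ :=
  ∑ h ∈ Finset.range (j+1), ∑ l ∈ Finset.range (j+1), aq j h * aq j l * (1 / (s + (2^h + 2^l))^2)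

lemma AA_cont (j : ℕ) : Continuous (AA j) := by unfold AA; fun_prop

lemma AA_deriv (j : ℕ) (t : ℝ) :
    HasDerivAt (AA (j+1)) (2^(j+1) * AA j t - 2^(j+1) * AA (j+1) t) t := by
  have h1 : HasDerivAt (AA (j+1)) (∑ h ∈ Finset.range (j+1+1),
      aq (j+1) h * (Real.exp (-(2:ℝ)^h * t) * (-(2:ℝ)^h * 1))) t := by
    unfold AA
    refine HasDerivAt.fun_sum fun h _ => ?_
    exact (((hasDerivAt_id t).const_mul (-(2:ℝ)^h)).exp).const_mul _
  refine h1.congr_deriv ?_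
  have := bq_rec j (fun h => 4^h * Real.exp (-(2:ℝ)^h * t))
  have e : AA j t = ∑ h ∈ Finset.range (j+1), bq j h * (4^h * Real.exp (-(2:ℝ)^h * t)) := by
    unfold AA aq
    refine Finset.sum_congr rfl fun _ _ => by ring
  rw [e, ← this]
  unfold AA aq
  rw [Finset.mul_sum, ← Finset.sum_sub_distrib]
  refine Finset.sum_congr rfl fun _ _ => by ring

lemma AA_zero (j : ℕ) : AA (j+3) 0 = 0 := by
  unfold AA aq
  simpa using m2 j

lemma AA_two (t : ℝ) (ht : 0 ≤ t) : |AA 2 t| ≤ 2048 := by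
  unfold AA
  refine (Finset.abs_sum_le_sum_abs _ _).trans (le_trans (Finset.sum_le_sum fun h _ => ?_) (aq_sum 2))
  rw [abs_mul, abs_of_pos (Real.exp_pos _)]
  refine mul_le_of_le_one_right (abs_nonneg _) ?_
  rw [Real.exp_le_one_iff]
  have : (0:ℝ) < 2^h := by positivity
  nlinarith

/-- tail product bound `D` -/
noncomputable def DD (σ : ℝ) (n : ℕ) : ℝ := ∏ i ∈ Finset.range n, (1 + (1/2)^(i+3) * σ)

lemma DD_pos (σ : ℝ) (hσ : 0 ≤ σ) (n : ℕ) : 0 < DD σ n :=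
  Finset.prod_pos fun i _ => by positivity

lemma AA_formula (j : ℕ) (t : ℝ) :
    AA (j+3) t = Real.exp (-(2:ℝ)^(j+3) * t) *
      ∫ u in (0:ℝ)..t, 2^(j+3) * AA (j+2) u * Real.exp ((2:ℝ)^(j+3) * u) := by
  have h := intervalIntegral.integral_eq_sub_of_hasDerivAt (a := 0) (b := t)
    (f := fun u => AA (j+3) u * Real.exp ((2:ℝ)^(j+3) * u))
    (f' := fun u => 2^(j+3) * AA (j+2) u * Real.exp ((2:ℝ)^(j+3) * u)) ?_ ?_
  · rw [h, AA_zero, zero_mul, sub_zero, mul_left_comm, ← Real.exp_add]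
    simp
  · intro u _
    have h2 : HasDerivAt (fun x : ℝ => Real.exp ((2:ℝ)^(j+3) * x))
        (Real.exp ((2:ℝ)^(j+3) * u) * ((2:ℝ)^(j+3) * 1)) u :=
      ((hasDerivAt_id u).const_mul _).exp
    refine ((AA_deriv (j+2) u).mul h2).congr_deriv ?_
    ring
  · have := AA_cont (j+2)
    exact Continuous.intervalIntegrable (by fun_prop) _ _

lemma AA_bd (σ : ℝ) (hσ : 0 < σ) (n : ℕ) : ∀ t, 0 ≤ t →
    |AA (n+2) t| ≤ 2048 / DD σ n * Real.exp (σ * t) := by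
  induction n with
  | zero =>
    intro t ht
    have := AA_two t ht
    have h1 : 1 ≤ Real.exp (σ * t) := Real.one_le_exp (by positivity)
    simp only [DD, Finset.range_zero, Finset.prod_empty, zero_add]
    linarith
  | succ n ih =>
    intro t ht
    have hD := DD_pos σ hσ.le n
    rw [show n + 1 + 2 = n + 3 by ring, AA_formula, abs_mul, abs_of_pos (Real.exp_pos _)]
    set lam : ℝ := 2^(n+3) with hlam
    have hl : 0 < lam := by positivity
    set K := 2048 / DD σ n with hK
    have hK0 : 0 < K := by positivity
    have h1 : |∫ u in (0:ℝ)..t, lam * AA (n+2) u * Real.exp (lam * u)| ≤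
        ∫ u in (0:ℝ)..t, lam * K * Real.exp ((lam + σ) * u) := by
      rw [← Real.norm_eq_abs]
      refine intervalIntegral.norm_integral_le_of_norm_le ht ?_ ?_
      · refine Eventually.of_forall fun u hu => ?_
        rw [Real.norm_eq_abs, abs_mul, abs_mul, abs_of_pos hl, abs_of_pos (Real.exp_pos _),
          add_mul lam σ u, Real.exp_add]
        have := ih u hu.1.le
        calc _ ≤ lam * (K * Real.exp (σ * u)) * Real.exp (lam * u) := by gcongr
          _ = _ := by ring
      · exact Continuous.intervalIntegrable (by fun_prop) _ _
    have h2 : ∫ u in (0:ℝ)..t, lam * K * Real.exp ((lam + σ) * u) =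
        lam * K / (lam + σ) * Real.exp ((lam + σ) * t) - lam * K / (lam + σ) := by
      have := intervalIntegral.integral_eq_sub_of_hasDerivAt (a := 0) (b := t)
        (f := fun u => lam * K / (lam + σ) * Real.exp ((lam + σ) * u))
        (f' := fun u => lam * K * Real.exp ((lam + σ) * u)) ?_ ?_
      · rw [this]; simp
      · intro u _
        refine ((((hasDerivAt_id u).const_mul (lam + σ)).exp).const_mul
          (lam * K / (lam + σ))).congr_deriv ?_
        simp only [id]
        field_simp
      · exact Continuous.intervalIntegrable (by fun_prop) _ _
    have h3 : 2048 / DD σ (n+1) = lam * K / (lam + σ) := by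
      have e : DD σ (n+1) = DD σ n * (1 + (1/2)^(n+3) * σ) := by
        unfold DD; rw [Finset.prod_range_succ]
      have e2 : (1/2:ℝ)^(n+3) = 1 / lam := by rw [hlam]; simp
      rw [e, hK, e2]
      field_simp
    rw [h3]
    have h4 : 0 < lam * K / (lam + σ) := by positivity
    calc _ ≤ Real.exp (-lam * t) * (lam * K / (lam + σ) * Real.exp ((lam + σ) * t)) := by
          gcongr
          rw [h2] at h1
          linarith
      _ = lam * K / (lam + σ) * (Real.exp (-lam * t) * Real.exp ((lam + σ) * t)) := by ring
      _ = _ := by rw [← Real.exp_add]; ring_nf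

open MeasureTheory in
lemma SS_int (j : ℕ) (s : ℝ) (hs : 0 < s) :
    SS j s = ∫ t in Set.Ioi (0:ℝ), t * Real.exp (-s * t) * AA j t ^ 2 := by
  have e : ∀ t, t * Real.exp (-s * t) * AA j t ^ 2 =
      ∑ h ∈ Finset.range (j+1), ∑ l ∈ Finset.range (j+1),
        aq j h * aq j l * (t * Real.exp (-(s + (2^h + 2^l)) * t)) := by
    intro t
    unfold AA
    rw [pow_two, Finset.sum_mul_sum, Finset.mul_sum]
    refine Finset.sum_congr rfl fun h _ => ?_
    rw [Finset.mul_sum]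
    refine Finset.sum_congr rfl fun l _ => ?_
    have : Real.exp (-(s + (2^h + 2^l)) * t) =
        Real.exp (-s * t) * Real.exp (-(2:ℝ)^h * t) * Real.exp (-(2:ℝ)^l * t) := by
      rw [← Real.exp_add, ← Real.exp_add]; ring_nf
    rw [this]; ring
  have hi : ∀ h l : ℕ, IntegrableOn (fun t : ℝ =>
      aq j h * aq j l * (t * Real.exp (-(s + (2^h + 2^l)) * t))) (Set.Ioi 0) := by
    intro h l
    have := int_pow 1 (s + (2^h + 2^l)) (by positivity)
    simp only [pow_one] at this
    exact this.const_mul _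
  simp only [e]
  rw [integral_finsetSum _ fun h _ => integrable_finsetSum _ fun l _ => hi h l]
  unfold SS
  refine Finset.sum_congr rfl fun h _ => ?_
  rw [integral_finsetSum _ fun l _ => hi h l]
  refine Finset.sum_congr rfl fun l _ => ?_
  rw [integral_const_mul, val_one _ (by positivity)]

open MeasureTheory in
lemma SS_bd (n : ℕ) (s : ℝ) (hs : 0 < s) :
    |SS (n+2) s| ≤ (2048 / DD (s/4) n)^2 * (4 / s^2) := by
  have hD := DD_pos (s/4) (by positivity) n
  have hi : IntegrableOn (fun t : ℝ =>
      (2048 / DD (s/4) n)^2 * (t * Real.exp (-(s/2) * t))) (Set.Ioi 0) := by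
    have := int_pow 1 (s/2) (by positivity)
    simp only [pow_one] at this
    exact this.const_mul _
  rw [SS_int _ _ hs, ← Real.norm_eq_abs]
  have := norm_integral_le_of_norm_le hi
    (f := fun t => t * Real.exp (-s * t) * AA (n+2) t ^ 2) ?_
  · refine this.trans (le_of_eq ?_)
    rw [integral_const_mul, val_one _ (by positivity)]
    congr 1
    field_simp
    norm_num
  · refine (ae_restrict_iff' measurableSet_Ioi).2 (Eventually.of_forall fun t ht => ?_)
    have ht' : (0:ℝ) < t := ht
    have hb := AA_bd (s/4) (by positivity) n t ht'.le
    rw [Real.norm_of_nonneg (by positivity), ← sq_abs (AA (n+2) t)]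
    have e : Real.exp (-(s/2) * t) = Real.exp (-s * t) * Real.exp (s/4*t) ^ 2 := by
      rw [← Real.exp_nat_mul, ← Real.exp_add]
      congr 1
      push_cast
      ring
    rw [e]
    calc _ ≤ t * Real.exp (-s * t) * (2048 / DD (s/4) n * Real.exp (s/4*t)) ^ 2 := by gcongr
      _ = _ := by ring

noncomputable def NN (s : ℝ) (j : ℕ) : ℝ := ∏ i ∈ Finset.range j, (1 + (1/2:ℝ)^i * s)

lemma NN_pos (s : ℝ) (hs : 0 ≤ s) (j : ℕ) : 0 < NN s j :=
  Finset.prod_pos fun i _ => by positivity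

lemma CC_bd (s : ℝ) (hs : 1 ≤ s) (n : ℕ) :
    (1/4)^(n+3) * NN s (n+3) ≤ (3/4)^n * (128 * s) * DD (s/4) (n+1)^2 := by
  induction n with
  | zero =>
    simp [NN, DD, Finset.prod_range_succ]
    have h1 : (1 + s) * (1 + 2⁻¹ * s) * (1 + (2 ^ 2)⁻¹ * s) ≤ (2 * s) * (2 * s) * (2 * s) := by
      gcongr <;> linarith
    have h2 : (s/32)^2 ≤ (1 + (2 ^ 3)⁻¹ * (s / 4))^2 := by
      gcongr
      linarith
    nlinarith [mul_le_mul_of_nonneg_left h2 (show 0 ≤ 128 * s by linarith)]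
  | succ n ih =>
    have e1 : NN s (n+1+3) = NN s (n+3) * (1 + (1/2:ℝ)^(n+3) * s) := by
      unfold NN; rw [show n+1+3 = n+3+1 by ring, Finset.prod_range_succ]
    have e2 : DD (s/4) (n+1+1) = DD (s/4) (n+1) * (1 + (1/2)^(n+1+3) * (s/4)) := by
      unfold DD; rw [Finset.prod_range_succ]
    rw [e1, e2]
    set y := (1/2:ℝ)^(n+3) * s with hy
    have e3 : (1/2:ℝ)^(n+1+3) * (s/4) = y / 8 := by
      rw [hy, show n+1+3 = n+3+1 by ring, pow_succ]; ring
    rw [e3]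
    have h3 : 1 + y ≤ 3 * (1 + y/8)^2 := by nlinarith [sq_nonneg (y - 8/3)]
    have hy0 : 0 ≤ y := by positivity
    calc _ = (1/4)^(n+3) * NN s (n+3) * ((1 + y) / 4) := by
            rw [show n+1+3 = n+3+1 by ring, pow_succ]; ring
      _ ≤ ((3/4)^n * (128 * s) * DD (s/4) (n+1)^2) * (3 * (1 + y/8)^2 / 4) := by
            gcongr
      _ = _ := by ring

noncomputable def TT (s : ℝ) (j : ℕ) : ℝ := (1/4)^j * NN s j * SS j s

lemma TT_tail (s : ℝ) (hs : 1 ≤ s) (n : ℕ) :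
    |TT s (n+3)| ≤ (2048^2 * 512 / s) * (3/4)^n := by
  have hs0 : 0 < s := by linarith
  have h1 := SS_bd (n+1) s hs0
  have h2 := CC_bd s hs n
  have hD := DD_pos (s/4) (by positivity) (n+1)
  have hN := NN_pos s hs0.le (n+3)
  unfold TT
  rw [abs_mul, abs_of_pos (by positivity)]
  calc _ ≤ ((3/4)^n * (128 * s) * DD (s/4) (n+1)^2) *
        ((2048 / DD (s/4) (n+1))^2 * (4 / s^2)) := by gcongr
    _ = _ := by field_simp; norm_num

lemma SS_crude (j : ℕ) (s : ℝ) (hs : 0 < s) : |SS j s| ≤ 2048^2 / s^2 := by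
  unfold SS
  calc _ ≤ ∑ h ∈ Finset.range (j+1), ∑ l ∈ Finset.range (j+1), |aq j h| * |aq j l| * (1 / s^2) := by
        refine (Finset.abs_sum_le_sum_abs _ _).trans (Finset.sum_le_sum fun h _ => ?_)
        refine (Finset.abs_sum_le_sum_abs _ _).trans (Finset.sum_le_sum fun l _ => ?_)
        rw [abs_mul, abs_mul, abs_of_pos (show 0 < 1 / (s + ((2:ℝ)^h + 2^l))^2 by positivity)]
        gcongr
        have : (0:ℝ) < 2^h + 2^l := by positivity
        linarith
    _ = (∑ h ∈ Finset.range (j+1), |aq j h|)^2 * (1 / s^2) := by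
        rw [pow_two (∑ h ∈ Finset.range (j+1), |aq j h|), Finset.sum_mul_sum, Finset.sum_mul]
        refine Finset.sum_congr rfl fun h _ => ?_
        rw [Finset.sum_mul]
    _ ≤ 2048^2 * (1/s^2) := by
        have := aq_sum j
        have h0 : 0 ≤ ∑ h ∈ Finset.range (j+1), |aq j h| := Finset.sum_nonneg fun _ _ => abs_nonneg _
        gcongr
    _ = _ := by ring

lemma SS_diff (s : ℝ) (hs : 1 ≤ s) : |SS 2 s * s^2 - 64| ≤ 2048^2 * 16 / s := by
  have hs0 : 0 < s := by linarith
  have h8 : ∑ h ∈ Finset.range 3, aq 2 h = 8 := by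
    simp [Finset.sum_range_succ, aq, bq, Q_zero, Q_succ, Nat.choose]
    norm_num
  have e : SS 2 s * s^2 - 64 = ∑ h ∈ Finset.range 3, ∑ l ∈ Finset.range 3,
      aq 2 h * aq 2 l * (s^2 / (s + (2^h + 2^l))^2 - 1) := by
    have : (64:ℝ) = ∑ h ∈ Finset.range 3, ∑ l ∈ Finset.range 3, aq 2 h * aq 2 l := by
      rw [← Finset.sum_mul_sum, h8]; norm_num
    rw [this]
    unfold SS
    rw [Finset.sum_mul, ← Finset.sum_sub_distrib]
    refine Finset.sum_congr rfl fun h _ => ?_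
    rw [Finset.sum_mul, ← Finset.sum_sub_distrib]
    refine Finset.sum_congr rfl fun l _ => ?_
    ring
  rw [e]
  calc _ ≤ ∑ h ∈ Finset.range 3, ∑ l ∈ Finset.range 3, |aq 2 h| * |aq 2 l| * (16 / s) := by
        refine (Finset.abs_sum_le_sum_abs _ _).trans (Finset.sum_le_sum fun h hh => ?_)
        refine (Finset.abs_sum_le_sum_abs _ _).trans (Finset.sum_le_sum fun l hl => ?_)
        rw [abs_mul, abs_mul]
        gcongr
        have b : ∀ h ∈ Finset.range 3, (2:ℝ)^h ≤ 4 := by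
          intro h hh
          have : h ≤ 2 := by simpa [Nat.lt_succ_iff] using hh
          calc (2:ℝ)^h ≤ 2^2 := pow_le_pow_right₀ (by norm_num) this
            _ = 4 := by norm_num
        have b1 := b h hh
        have b2 := b l hl
        have c0 : (0:ℝ) < 2^h + 2^l := by positivity
        have c1 : (2:ℝ)^h + 2^l ≤ 8 := by linarith
        generalize (2:ℝ)^h + 2^l = c at *
        have e : s^2 / (s + c)^2 - 1 = -((2 * s * c + c^2) / (s+c)^2) := by
          field_simp
          ring
        rw [e, abs_neg, abs_of_pos (by positivity), div_le_div_iff₀ (by positivity) hs0]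
        nlinarith [mul_pos hs0 c0, mul_pos (mul_pos hs0 c0) hs0, mul_pos (mul_pos hs0 c0) c0,
          mul_nonneg (mul_pos hs0 hs0).le (sub_nonneg.2 c1),
          mul_nonneg (mul_pos hs0 c0).le (sub_nonneg.2 c1)]
    _ = (∑ h ∈ Finset.range 3, |aq 2 h|)^2 * (16 / s) := by
        rw [pow_two (∑ h ∈ Finset.range 3, |aq 2 h|), Finset.sum_mul_sum, Finset.sum_mul]
        refine Finset.sum_congr rfl fun h _ => ?_
        rw [Finset.sum_mul]
    _ ≤ 2048^2 * (16/s) := by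
        have := aq_sum 2
        have h0 : 0 ≤ ∑ h ∈ Finset.range 3, |aq 2 h| := Finset.sum_nonneg fun _ _ => abs_nonneg _
        gcongr
    _ = _ := by ring

lemma TT_zero (s : ℝ) (hs : 1 ≤ s) : |TT s 0| ≤ 2048^2 / s := by
  have h := SS_crude 0 s (by linarith)
  simp only [TT, NN, pow_zero, Finset.range_zero, Finset.prod_empty, one_mul]
  refine h.trans ?_
  gcongr
  nlinarith

lemma TT_one (s : ℝ) (hs : 1 ≤ s) : |TT s 1| ≤ 2048^2 / s := by
  have hs0 : 0 < s := by linarith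
  have h := SS_crude 1 s hs0
  simp only [TT, NN, pow_one, Finset.range_one, Finset.prod_singleton, pow_zero, one_mul]
  rw [abs_mul, abs_of_pos (by positivity)]
  calc _ ≤ s * (2048^2 / s^2) := by
        gcongr
        linarith
    _ = _ := by field_simp

lemma TT_two (s : ℝ) (hs : 1 ≤ s) : |TT s 2 - 2| ≤ 2048^2 * 32 / s := by
  have hs0 : 0 < s := by linarith
  have h1 := SS_diff s hs
  have h2 := SS_crude 2 s hs0
  have e : TT s 2 - 2 = 1/32 * (SS 2 s * s^2 - 64) + 1/16 * (1 + 3/2 * s) * SS 2 s := by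
    simp only [TT, NN, Finset.prod_range_succ, Finset.range_zero, Finset.prod_empty]
    ring
  rw [e]
  refine (abs_add_le _ _).trans ?_
  rw [abs_mul, abs_mul (1/16 * (1 + 3/2*s)), abs_of_pos (show (0:ℝ) < 1/32 by norm_num),
    abs_of_pos (show 0 < 1/16 * (1 + 3/2 * s) by positivity)]
  calc _ ≤ 1/32 * (2048^2 * 16 / s) + s * (2048^2 / s^2) := by
        gcongr
        linarith
    _ = 2048^2 * (3/2) / s := by field_simp; norm_num
    _ ≤ _ := by gcongr; norm_num

noncomputable def FF (j r : ℕ) (x : ℝ) : ℝ :=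
  ∑ h ∈ Finset.range (j+1), ∑ l ∈ Finset.range (j+1),
    (1/2)^j * beta r * (aq j h * aq j l) * phi ((2:ℝ)^(r+j)) ((2:ℝ)^h + (2:ℝ)^l) x

lemma G_eq (x : ℝ) : G x = ∑' j, ∑' r, FF j r x := by
  unfold G FF
  refine tsum_congr fun j => tsum_congr fun r => Finset.sum_congr rfl fun h _ =>
    Finset.sum_congr rfl fun l _ => ?_
  have e : (2:ℝ)^(-(j:ℤ) - (r.choose 2 : ℤ) - (h.choose 2 : ℤ) - (l.choose 2 : ℤ)
        + 2*(h:ℤ) + 2*(l:ℤ)) = (1/2)^j * (1/2)^(r.choose 2) * (1/2)^(h.choose 2) *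
          (1/2)^(l.choose 2) * 4^h * 4^l := by
    have h2 : (2:ℝ) ≠ 0 := by norm_num
    rw [zpow_add₀ h2, zpow_add₀ h2, zpow_sub₀ h2, zpow_sub₀ h2, zpow_sub₀ h2, zpow_neg,
      zpow_mul, zpow_mul]
    simp only [zpow_natCast, div_eq_mul_inv]
    norm_num
    simp only [one_div, inv_pow]
  rw [e, pow_add, pow_add]
  unfold beta aq bq
  have h1 := (Q_pos h).ne'
  have h2 := (Q_pos l).ne'
  have h3 := (Q_pos r).ne'
  have h4 := (Q_pos (j-h)).ne'
  have h5 := (Q_pos (j-l)).ne'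
  have h6 := Qinf_pos.ne'
  field_simp

lemma sumjr (c : ℝ) : Summable (fun p : ℕ × ℕ => (1/2:ℝ)^p.1 * (1024 * (1/8:ℝ)^p.2) * c) :=
  (Summable.mul_of_nonneg (f := fun j : ℕ => (1/2:ℝ)^j) (g := fun r : ℕ => 1024 * (1/8:ℝ)^r)
    summable_geometric_two sum8 (fun _ => by positivity) (fun _ => by positivity)).mul_right c

lemma FF_bd (j r : ℕ) (x : ℝ) (hx : 0 ≤ x) :
    |FF j r x| ≤ (1/2)^j * (1024 * (1/8:ℝ)^r) * (2048^2 * x^2) := by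
  unfold FF
  calc _ ≤ ∑ h ∈ Finset.range (j+1), ∑ l ∈ Finset.range (j+1),
        (1/2)^j * |beta r| * (|aq j h| * |aq j l|) * x^2 := by
        refine (Finset.abs_sum_le_sum_abs _ _).trans (Finset.sum_le_sum fun h _ => ?_)
        refine (Finset.abs_sum_le_sum_abs _ _).trans (Finset.sum_le_sum fun l _ => ?_)
        rw [abs_mul, abs_mul, abs_mul, abs_mul, abs_of_pos (show (0:ℝ) < (1/2)^j by positivity),
          abs_of_nonneg (phi_nonneg _ _ x hx)]
        gcongr
        exact phi_le _ _ x (by positivity) (by positivity) hx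
    _ = (1/2)^j * |beta r| * ((∑ h ∈ Finset.range (j+1), |aq j h|)^2 * x^2) := by
        rw [pow_two (∑ h ∈ Finset.range (j+1), |aq j h|), Finset.sum_mul_sum, Finset.sum_mul,
          Finset.mul_sum]
        refine Finset.sum_congr rfl fun h _ => ?_
        rw [Finset.sum_mul, Finset.mul_sum]
        refine Finset.sum_congr rfl fun l _ => ?_
        ring
    _ ≤ _ := by
        have := aq_sum j
        have h0 : 0 ≤ ∑ h ∈ Finset.range (j+1), |aq j h| := Finset.sum_nonneg fun _ _ => abs_nonneg _
        have := beta_bd r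
        gcongr

lemma G_eq' (x : ℝ) (hx : 0 ≤ x) : G x = ∑' p : ℕ × ℕ, FF p.1 p.2 x := by
  rw [G_eq]
  have hs : Summable (fun p : ℕ × ℕ => FF p.1 p.2 x) :=
    Summable.of_norm_bounded (sumjr (2048^2 * x^2)) fun p => FF_bd p.1 p.2 x hx
  exact hs.tsum_prod.symm

open MeasureTheory in
lemma FF_int (j r : ℕ) (s : ℝ) (hs : 0 < s) :
    IntegrableOn (fun x => Real.exp (-s * x) * FF j r x) (Set.Ioi 0) ∧
    ∫ x in Set.Ioi (0:ℝ), Real.exp (-s * x) * FF j r x =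
      (1/2)^j * SS j s * (beta r * (1 / (s + 2^(r+j)))) := by
  have e : ∀ x, Real.exp (-s * x) * FF j r x = ∑ h ∈ Finset.range (j+1), ∑ l ∈ Finset.range (j+1),
      ((1/2)^j * beta r * (aq j h * aq j l)) *
        (Real.exp (-s * x) * phi ((2:ℝ)^(r+j)) ((2:ℝ)^h + (2:ℝ)^l) x) := by
    intro x
    unfold FF
    rw [Finset.mul_sum]
    refine Finset.sum_congr rfl fun h _ => ?_
    rw [Finset.mul_sum]
    refine Finset.sum_congr rfl fun l _ => ?_
    ring
  have hi : ∀ h l : ℕ, IntegrableOn (fun x => ((1/2)^j * beta r * (aq j h * aq j l)) *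
        (Real.exp (-s * x) * phi ((2:ℝ)^(r+j)) ((2:ℝ)^h + (2:ℝ)^l) x)) (Set.Ioi 0) := by
    intro h l
    exact (phi_int _ _ s (by positivity) (by positivity) hs).const_mul _
  simp only [e]
  refine ⟨integrable_finsetSum _ fun h _ => integrable_finsetSum _ fun l _ => hi h l, ?_⟩
  rw [integral_finsetSum _ fun h _ => integrable_finsetSum _ fun l _ => hi h l]
  unfold SS
  rw [Finset.mul_sum, Finset.sum_mul]
  refine Finset.sum_congr rfl fun h _ => ?_
  rw [integral_finsetSum _ fun l _ => hi h l, Finset.mul_sum, Finset.sum_mul]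
  refine Finset.sum_congr rfl fun l _ => ?_
  rw [integral_const_mul, phi_laplace _ _ s (by positivity) (by positivity) hs]
  ring

open MeasureTheory in
lemma laplace_sum (s : ℝ) (hs : 0 < s) :
    HasSum (fun p : ℕ × ℕ => (1/2)^p.1 * SS p.1 s * (beta p.2 * (1 / (s + 2^(p.2+p.1)))))
      (∫ x in Set.Ioi (0:ℝ), Real.exp (-s * x) * G x) := by
  have h := hasSum_integral_of_summable_integral_norm (μ := volume.restrict (Set.Ioi (0:ℝ)))
    (F := fun (p : ℕ × ℕ) x => Real.exp (-s * x) * FF p.1 p.2 x)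
    (fun p => (FF_int p.1 p.2 s hs).1) ?_
  · simp only [(FF_int _ _ s hs).2] at h
    convert! h using 1
    refine setIntegral_congr_fun measurableSet_Ioi fun x hx => ?_
    rw [tsum_mul_left, G_eq' x (le_of_lt hx)]
  · refine Summable.of_nonneg_of_le (fun p => integral_nonneg fun x => norm_nonneg _) (fun p => ?_)
      (sumjr (2048^2 * ∫ x in Set.Ioi (0:ℝ), x^2 * Real.exp (-s * x)))
    have : (1/2:ℝ)^p.1 * (1024 * (1/8:ℝ)^p.2) *
        (2048^2 * ∫ x in Set.Ioi (0:ℝ), x^2 * Real.exp (-s * x)) =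
        ∫ x in Set.Ioi (0:ℝ), (1/2:ℝ)^p.1 * (1024 * (1/8:ℝ)^p.2) * 2048^2 *
          (x^2 * Real.exp (-s * x)) := by
      rw [integral_const_mul]; ring
    rw [this]
    refine setIntegral_mono_on (FF_int p.1 p.2 s hs).1.norm ((int_pow 2 s hs).const_mul _)
      measurableSet_Ioi fun x hx => ?_
    rw [norm_mul, Real.norm_of_nonneg (Real.exp_pos _).le, Real.norm_eq_abs]
    calc _ ≤ Real.exp (-s * x) * ((1/2)^p.1 * (1024 * (1/8:ℝ)^p.2) * (2048^2 * x^2)) := by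
          gcongr
          exact FF_bd p.1 p.2 x (le_of_lt hx)
      _ = _ := by ring

lemma laplace_TT (s : ℝ) (hs : 0 < s) :
    (∫ x in Set.Ioi (0:ℝ), Real.exp (-s * x) * G x) * PP s = ∑' j, TT s j := by
  have h := laplace_sum s hs
  rw [← h.tsum_eq, h.summable.tsum_prod, ← tsum_mul_right]
  refine tsum_congr fun j => ?_
  simp only
  rw [tsum_mul_left, mul_assoc, pf_shift s hs j]
  unfold TT NN
  rw [show (1/4:ℝ) = 1/2 * (1/2) by norm_num, mul_pow]
  ring

/-- The Laplace transform of `G` satisfies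
`∫_0^∞ e^{−sx} G(x) dx = (2/∏_{j≥0}(1 + 2^{−j}s))(1 + O(1/s))` as `s → ∞`. -/
theorem laplace_transform_G_asymptotics :
    ∃ C > (0:ℝ), ∃ s₀ : ℝ, 1 ≤ s₀ ∧ ∀ s : ℝ, s₀ ≤ s →
      |(∫ x in Set.Ioi (0:ℝ), Real.exp (-s * x) * G x) *
          (∏' j : ℕ, (1 + (2:ℝ)^(-(j:ℤ)) * s)) / 2 - 1| ≤ C / s := by
  refine ⟨2048^2 * 2000, by norm_num, 1, le_rfl, fun s hs => ?_⟩
  have hs0 : 0 < s := by linarith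
  change |(∫ x in Set.Ioi (0:ℝ), Real.exp (-s * x) * G x) * PP s / 2 - 1| ≤ _
  rw [laplace_TT s hs0]
  have hg : HasSum (fun n : ℕ => (2048^2 * 512 / s) * (3/4:ℝ)^n) ((2048^2 * 512 / s) * 4) := by
    have := (hasSum_geometric_of_lt_one (r := (3/4:ℝ)) (by norm_num) (by norm_num)).mul_left
      (2048^2 * 512 / s)
    norm_num at this ⊢
    exact this
  have hsum3 : Summable (fun n => TT s (n+3)) :=
    Summable.of_norm_bounded hg.summable fun n => TT_tail s hs n
  have hsum : Summable (TT s) := (summable_nat_add_iff 3).1 hsum3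
  have ht : |∑' n, TT s (n+3)| ≤ (2048^2 * 512 / s) * 4 :=
    tsum_of_norm_bounded (f := fun n => TT s (n+3)) hg fun n => TT_tail s hs n
  rw [← hsum.sum_add_tsum_nat_add 3]
  simp only [Finset.sum_range_succ, Finset.range_zero, Finset.sum_empty, zero_add]
  have h0 := abs_le.1 (TT_zero s hs)
  have h1 := abs_le.1 (TT_one s hs)
  have h2 := abs_le.1 (TT_two s hs)
  have h3 := abs_le.1 ht
  have hp : 0 < s⁻¹ := by positivity
  simp only [div_eq_mul_inv] at h0 h1 h2 h3 ⊢
  generalize s⁻¹ = w at *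
  rw [abs_le]
  constructor <;> linarith
end
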